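/- arXiv:1304.2141 — 3 statements merged into one kernel-verified Lean document; each statement's English description precedes it below -/
import Mathlib

section
/- Let a < b, let p : [a,b] → ℝ and q : [a,b] → ℝ be nonincreasing with p(x) ≤ a and q(x) ≥ b for all x ∈ [a,b], and let L be the associated Lagrangian. Then for every x ∈ (a,b), L(x,y) = 0 for all y in the closed interval [lim_{z↓x} q(z), lim_{z↑x} q(z)], and L(x,y) = 0 for all y in the closed interval [lim_{z↓x} p(z), lim_{z↑x} p(z)] (one-sided limits exist by monotonicity). -/
open Set MeasureTheory intervalIntegral
open scoped Classical

noncomputable section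

/-- θ(x) = ∫_{x₀}^x 2/(q z − p z) dz -/
def thetaFn (p q : ℝ → ℝ) (x₀ x : ℝ) : ℝ := ∫ z in x₀..x, 2 / (q z - p z)

/-- α(x) = ∫_{x₀}^x (2x − q z − p z)/(q z − p z) dz -/
def alphaFn (p q : ℝ → ℝ) (x₀ x : ℝ) : ℝ :=
  ∫ z in x₀..x, (2 * x - q z - p z) / (q z - p z)

/-- right-continuous inverse of p : p_R⁻¹(y) = inf {x ∈ [a,b] : p x ≤ y}, = b if empty. -/
def pRinv (a b : ℝ) (p : ℝ → ℝ) (y : ℝ) : ℝ :=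
  if ({x | x ∈ Icc a b ∧ p x ≤ y}).Nonempty then sInf {x | x ∈ Icc a b ∧ p x ≤ y} else b

/-- left-continuous inverse of q : q_L⁻¹(y) = sup {x ∈ [a,b] : q x ≥ y}, = a if empty. -/
def qLinv (a b : ℝ) (q : ℝ → ℝ) (y : ℝ) : ℝ :=
  if ({x | x ∈ Icc a b ∧ y ≤ q x}).Nonempty then sSup {x | x ∈ Icc a b ∧ y ≤ q x} else a

def deltaFn (a b x₀ : ℝ) (p q : ℝ → ℝ) (x : ℝ) : ℝ :=
  if x < a then thetaFn p q x₀ (pRinv a b p x)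
  else if x ≤ b then thetaFn p q x₀ x
  else thetaFn p q x₀ (qLinv a b q x)

def psiFn (a b x₀ : ℝ) (p q : ℝ → ℝ) (x : ℝ) : ℝ :=
  if x < a then
    alphaFn p q x₀ (pRinv a b p x)
      + (pRinv a b p x - x) * (1 - thetaFn p q x₀ (pRinv a b p x))
  else if x ≤ b then alphaFn p q x₀ x
  else
    alphaFn p q x₀ (qLinv a b q x)
      + (qLinv a b q x - x) * (-1 - thetaFn p q x₀ (qLinv a b q x))

def LagFn (a b x₀ : ℝ) (p q : ℝ → ℝ) (x y : ℝ) : ℝ :=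
  |y - x| + psiFn a b x₀ p q x - psiFn a b x₀ p q y + deltaFn a b x₀ p q x * (y - x)

section ConstantPieces

variable {a b x₀ s t y : ℝ} {p q : ℝ → ℝ}

lemma intervalIntegrable_div_sub (hp : AntitoneOn p (Icc a b)) (hq : AntitoneOn q (Icc a b))
    (hab : a < b) (hpa : ∀ x ∈ Icc a b, p x ≤ a) (hqb : ∀ x ∈ Icc a b, b ≤ q x)
    {f : ℝ → ℝ} (hf : IntegrableOn f (Icc a b)) (hs : s ∈ Icc a b) (ht : t ∈ Icc a b) :
    IntervalIntegrable (fun z ↦ f z / (q z - p z)) volume s t := by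
  have hpi : IntegrableOn p (Icc a b) := hp.integrableOn_isCompact isCompact_Icc
  have hqi : IntegrableOn q (Icc a b) := hq.integrableOn_isCompact isCompact_Icc
  have key : IntegrableOn (fun z ↦ f z * (q z - p z)⁻¹) (Icc a b) := by
    refine Integrable.mul_bdd (c := (b - a)⁻¹) hf
      (hqi.sub hpi).aestronglyMeasurable.aemeasurable.inv.aestronglyMeasurable ?_
    filter_upwards [ae_restrict_mem measurableSet_Icc] with z hz
    have h₁ := hpa z hz
    have h₂ := hqb z hz
    rw [Real.norm_eq_abs, abs_inv, abs_of_pos (by linarith)]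
    exact inv_anti₀ (by linarith) (by linarith)
  exact (key.mono_set (uIcc_subset_Icc hs ht)).intervalIntegrable

lemma thetaFn_sub (hp : AntitoneOn p (Icc a b)) (hq : AntitoneOn q (Icc a b))
    (hab : a < b) (hpa : ∀ x ∈ Icc a b, p x ≤ a) (hqb : ∀ x ∈ Icc a b, b ≤ q x)
    (hx₀ : x₀ ∈ Icc a b) (hs : s ∈ Icc a b) (ht : t ∈ Icc a b) :
    thetaFn p q x₀ t - thetaFn p q x₀ s = ∫ z in s..t, 2 / (q z - p z) := by
  have hc : IntegrableOn (fun _ : ℝ ↦ (2 : ℝ)) (Icc a b) := by simp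
  exact integral_interval_sub_left
    (intervalIntegrable_div_sub hp hq hab hpa hqb hc hx₀ ht)
    (intervalIntegrable_div_sub hp hq hab hpa hqb hc hx₀ hs)

lemma alphaFn_sub (hp : AntitoneOn p (Icc a b)) (hq : AntitoneOn q (Icc a b))
    (hab : a < b) (hpa : ∀ x ∈ Icc a b, p x ≤ a) (hqb : ∀ x ∈ Icc a b, b ≤ q x)
    (hx₀ : x₀ ∈ Icc a b) (hs : s ∈ Icc a b) (ht : t ∈ Icc a b) :
    alphaFn p q x₀ t - alphaFn p q x₀ s =
      t * thetaFn p q x₀ t - s * thetaFn p q x₀ s - ∫ z in s..t, (q z + p z) / (q z - p z) := by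
  have hpi : IntegrableOn p (Icc a b) := hp.integrableOn_isCompact isCompact_Icc
  have hqi : IntegrableOn q (Icc a b) := hq.integrableOn_isCompact isCompact_Icc
  have hc : IntegrableOn (fun _ : ℝ ↦ (2 : ℝ)) (Icc a b) := by simp
  have hi {u : ℝ} (hu : u ∈ Icc a b) :
      IntervalIntegrable (fun z ↦ (q z + p z) / (q z - p z)) volume x₀ u :=
    intervalIntegrable_div_sub hp hq hab hpa hqb (hqi.add hpi) hx₀ hu
  have hα {u : ℝ} (hu : u ∈ Icc a b) : alphaFn p q x₀ u =
      u * thetaFn p q x₀ u - ∫ z in x₀..u, (q z + p z) / (q z - p z) := by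
    unfold alphaFn thetaFn
    rw [← intervalIntegral.integral_const_mul, ← intervalIntegral.integral_sub
      ((intervalIntegrable_div_sub hp hq hab hpa hqb hc hx₀ hu).const_mul u) (hi hu)]
    congr 1 with z
    ring
  have h := integral_interval_sub_left (hi ht) (hi hs)
  rw [hα ht, hα hs, ← h]
  ring

lemma alphaFn_sub_of_upper_const (hp : AntitoneOn p (Icc a b)) (hq : AntitoneOn q (Icc a b))
    (hab : a < b) (hpa : ∀ x ∈ Icc a b, p x ≤ a) (hqb : ∀ x ∈ Icc a b, b ≤ q x)
    (hx₀ : x₀ ∈ Icc a b) (hs : s ∈ Icc a b) (ht : t ∈ Icc a b) (hst : s ≤ t)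
    (hy : ∀ z ∈ Ioo s t, q z = y) :
    alphaFn p q x₀ t - alphaFn p q x₀ s =
      (t - y) * thetaFn p q x₀ t - (s - y) * thetaFn p q x₀ s + (t - s) := by
  have hc : IntegrableOn (fun _ : ℝ ↦ (2 : ℝ)) (Icc a b) := by simp
  have h : ∫ z in s..t, (q z + p z) / (q z - p z) =
      ∫ z in s..t, (y * (2 / (q z - p z)) - 1) := by
    refine intervalIntegral.integral_congr_Ioo_of_le hst fun z hz ↦ ?_
    have hz' : z ∈ Icc a b := ⟨hs.1.trans hz.1.le, hz.2.le.trans ht.2⟩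
    have h₁ := hpa z hz'
    have h₂ := hqb z hz'
    have h₃ : q z - p z ≠ 0 := by linarith
    simp only [← hy z hz]
    field_simp
    ring
  rw [alphaFn_sub hp hq hab hpa hqb hx₀ hs ht, h, intervalIntegral.integral_sub
    ((intervalIntegrable_div_sub hp hq hab hpa hqb hc hs ht).const_mul y) (by simp),
    intervalIntegral.integral_const_mul, ← thetaFn_sub hp hq hab hpa hqb hx₀ hs ht]
  simp only [intervalIntegral.integral_const, smul_eq_mul]
  ring

lemma alphaFn_sub_of_lower_const (hp : AntitoneOn p (Icc a b)) (hq : AntitoneOn q (Icc a b))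
    (hab : a < b) (hpa : ∀ x ∈ Icc a b, p x ≤ a) (hqb : ∀ x ∈ Icc a b, b ≤ q x)
    (hx₀ : x₀ ∈ Icc a b) (hs : s ∈ Icc a b) (ht : t ∈ Icc a b) (hst : s ≤ t)
    (hy : ∀ z ∈ Ioo s t, p z = y) :
    alphaFn p q x₀ t - alphaFn p q x₀ s =
      (t - y) * thetaFn p q x₀ t - (s - y) * thetaFn p q x₀ s - (t - s) := by
  have hc : IntegrableOn (fun _ : ℝ ↦ (2 : ℝ)) (Icc a b) := by simp
  have h : ∫ z in s..t, (q z + p z) / (q z - p z) =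
      ∫ z in s..t, (y * (2 / (q z - p z)) + 1) := by
    refine intervalIntegral.integral_congr_Ioo_of_le hst fun z hz ↦ ?_
    have hz' : z ∈ Icc a b := ⟨hs.1.trans hz.1.le, hz.2.le.trans ht.2⟩
    have h₁ := hpa z hz'
    have h₂ := hqb z hz'
    have h₃ : q z - p z ≠ 0 := by linarith
    simp only [← hy z hz]
    field_simp
    ring
  rw [alphaFn_sub hp hq hab hpa hqb hx₀ hs ht, h, intervalIntegral.integral_add
    ((intervalIntegrable_div_sub hp hq hab hpa hqb hc hs ht).const_mul y) (by simp),
    intervalIntegral.integral_const_mul, ← thetaFn_sub hp hq hab hpa hqb hx₀ hs ht]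
  simp only [intervalIntegral.integral_const, smul_eq_mul]
  ring

end ConstantPieces

section Inverses

variable {a b x y : ℝ} {p q : ℝ → ℝ}

lemma qLinv_spec (hx : x ∈ Ioo a b) (hl : ∀ z ∈ Ioo a x, y ≤ q z) :
    qLinv a b q y ∈ Icc x b ∧
      ∀ z ∈ Ico a (qLinv a b q y), ∃ w ∈ Icc a b, z < w ∧ y ≤ q w := by
  have hmem {z : ℝ} (hz : z ∈ Ioo a x) : z ∈ {x | x ∈ Icc a b ∧ y ≤ q x} :=
    ⟨⟨hz.1.le, (hz.2.trans hx.2).le⟩, hl z hz⟩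
  have hne : ({x | x ∈ Icc a b ∧ y ≤ q x}).Nonempty := (exists_between hx.1).imp fun _ ↦ hmem
  have hbd : BddAbove {x | x ∈ Icc a b ∧ y ≤ q x} := ⟨b, fun _ hz ↦ hz.1.2⟩
  rw [qLinv, if_pos hne]
  refine ⟨⟨?_, csSup_le hne fun _ hz ↦ hz.1.2⟩, fun z hz ↦ ?_⟩
  · refine le_of_forall_lt_imp_le_of_dense fun z hz ↦ ?_
    obtain ⟨w, hw, hw'⟩ := exists_between (max_lt hx.1 hz)
    exact ((le_max_right a z).trans hw.le).trans
      (le_csSup hbd (hmem ⟨(le_max_left a z).trans_lt hw, hw'⟩))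
  · obtain ⟨w, hw, hzw⟩ := exists_lt_of_lt_csSup hne hz.2
    exact ⟨w, hw.1, hzw, hw.2⟩

lemma pRinv_spec (hx : x ∈ Ioo a b) (hr : ∀ z ∈ Ioo x b, p z ≤ y) :
    pRinv a b p y ∈ Icc a x ∧
      ∀ z ∈ Ioc (pRinv a b p y) b, ∃ w ∈ Icc a b, w < z ∧ p w ≤ y := by
  have hmem {z : ℝ} (hz : z ∈ Ioo x b) : z ∈ {x | x ∈ Icc a b ∧ p x ≤ y} :=
    ⟨⟨(hx.1.trans hz.1).le, hz.2.le⟩, hr z hz⟩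
  have hne : ({x | x ∈ Icc a b ∧ p x ≤ y}).Nonempty := (exists_between hx.2).imp fun _ ↦ hmem
  have hbd : BddBelow {x | x ∈ Icc a b ∧ p x ≤ y} := ⟨a, fun _ hz ↦ hz.1.1⟩
  rw [pRinv, if_pos hne]
  refine ⟨⟨le_csInf hne fun _ hz ↦ hz.1.1, ?_⟩, fun z hz ↦ ?_⟩
  · refine le_of_forall_gt_imp_ge_of_dense fun z hz ↦ ?_
    obtain ⟨w, hw, hw'⟩ := exists_between (lt_min hx.2 hz)
    exact (csInf_le hbd (hmem ⟨hw, hw'.trans_le (min_le_left b z)⟩)).trans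
      (hw'.le.trans (min_le_right b z))
  · obtain ⟨w, hw, hzw⟩ := exists_lt_of_csInf_lt hne hz.1
    exact ⟨w, hw.1, hzw, hw.2⟩

end Inverses

lemma AntitoneOn.le_of_tendsto_nhdsWithin_Ioo_right {a b x z l : ℝ} {f : ℝ → ℝ}
    (hf : AntitoneOn f (Icc a b)) (hax : a ≤ x) (hz : z ∈ Ioo x b)
    (hl : Filter.Tendsto f (nhdsWithin x (Ioo x b)) (nhds l)) : f z ≤ l := by
  rw [nhdsWithin_Ioo_eq_nhdsGT (hz.1.trans hz.2)] at hl
  refine ge_of_tendsto hl ?_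
  filter_upwards [Ioo_mem_nhdsGT hz.1] with w hw
  exact hf ⟨hax.trans hw.1.le, (hw.2.trans hz.2).le⟩ ⟨hax.trans hz.1.le, hz.2.le⟩ hw.2.le

lemma AntitoneOn.ge_of_tendsto_nhdsWithin_Ioo_left {a b x z l : ℝ} {f : ℝ → ℝ}
    (hf : AntitoneOn f (Icc a b)) (hxb : x ≤ b) (hz : z ∈ Ioo a x)
    (hl : Filter.Tendsto f (nhdsWithin x (Ioo a x)) (nhds l)) : l ≤ f z := by
  rw [nhdsWithin_Ioo_eq_nhdsLT (hz.1.trans hz.2)] at hl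
  refine le_of_tendsto hl ?_
  filter_upwards [Ioo_mem_nhdsLT hz.2] with w hw
  exact hf ⟨hz.1.le, hz.2.le.trans hxb⟩ ⟨(hz.1.trans hw.1).le, hw.2.le.trans hxb⟩ hw.1.le

theorem stmt2 (a b x₀ : ℝ) (hab : a < b) (hx₀ : x₀ ∈ Icc a b)
    (p q : ℝ → ℝ)
    (hp : AntitoneOn p (Icc a b)) (hq : AntitoneOn q (Icc a b))
    (hpa : ∀ x ∈ Icc a b, p x ≤ a) (hqb : ∀ x ∈ Icc a b, b ≤ q x) :
    (∀ x ∈ Ioo a b, ∀ Lq_down Lq_up : ℝ,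
      Filter.Tendsto q (nhdsWithin x (Ioo x b)) (nhds Lq_down) →
      Filter.Tendsto q (nhdsWithin x (Ioo a x)) (nhds Lq_up) →
      ∀ y ∈ Icc Lq_down Lq_up, LagFn a b x₀ p q x y = 0) ∧
    (∀ x ∈ Ioo a b, ∀ Lp_down Lp_up : ℝ,
      Filter.Tendsto p (nhdsWithin x (Ioo x b)) (nhds Lp_down) →
      Filter.Tendsto p (nhdsWithin x (Ioo a x)) (nhds Lp_up) →
      ∀ y ∈ Icc Lp_down Lp_up, LagFn a b x₀ p q x y = 0) := by
  constructor
  · intro x hx l u hl hu y hy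
    have hx' : x ∈ Icc a b := Ioo_subset_Icc_self hx
    have hright : ∀ z ∈ Ioo x b, q z ≤ y := fun z hz ↦
      (hq.le_of_tendsto_nhdsWithin_Ioo_right hx.1.le hz hl).trans hy.1
    have hleft : ∀ z ∈ Ioo a x, y ≤ q z := fun z hz ↦
      hy.2.trans (hq.ge_of_tendsto_nhdsWithin_Ioo_left hx.2.le hz hu)
    have hby : b ≤ y := by
      obtain ⟨z, hz⟩ := exists_between hx.2
      exact (hqb z ⟨(hx.1.trans hz.1).le, hz.2.le⟩).trans (hright z hz)
    obtain ⟨t, ht, hconst, hψ⟩ : ∃ t ∈ Icc x b, (∀ z ∈ Ioo x t, q z = y) ∧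
        psiFn a b x₀ p q y =
          alphaFn p q x₀ t + (t - y) * (-1 - thetaFn p q x₀ t) := by
      rcases hby.eq_or_lt with rfl | hby
      · refine ⟨b, ⟨hx.2.le, le_rfl⟩, fun z hz ↦ (hright z hz).antisymm
          (hqb z ⟨(hx.1.trans hz.1).le, hz.2.le⟩), ?_⟩
        simp [psiFn, hab.not_gt]
      · obtain ⟨ht, hlt⟩ := qLinv_spec hx hleft
        refine ⟨_, ht, fun z hz ↦ (hright z ⟨hz.1, hz.2.trans_le ht.2⟩).antisymm ?_, ?_⟩
        · obtain ⟨w, hw, hzw, hyw⟩ := hlt z ⟨(hx.1.trans hz.1).le, hz.2⟩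
          exact hyw.trans (hq ⟨(hx.1.trans hz.1).le, hz.2.le.trans ht.2⟩ hw hzw.le)
        · simp [psiFn, (hab.trans hby).not_gt, hby.not_ge]
    have h := alphaFn_sub_of_upper_const hp hq hab hpa hqb hx₀ hx'
      ⟨hx.1.le.trans ht.1, ht.2⟩ ht.1 hconst
    rw [LagFn, hψ, psiFn, deltaFn, if_neg hx.1.not_gt, if_pos hx.2.le, if_neg hx.1.not_gt,
      if_pos hx.2.le, abs_of_nonneg (by linarith [hx.2])]
    linear_combination -h
  · intro x hx l u hl hu y hy
    have hx' : x ∈ Icc a b := Ioo_subset_Icc_self hx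
    have hright : ∀ z ∈ Ioo x b, p z ≤ y := fun z hz ↦
      (hp.le_of_tendsto_nhdsWithin_Ioo_right hx.1.le hz hl).trans hy.1
    have hleft : ∀ z ∈ Ioo a x, y ≤ p z := fun z hz ↦
      hy.2.trans (hp.ge_of_tendsto_nhdsWithin_Ioo_left hx.2.le hz hu)
    have hya : y ≤ a := by
      obtain ⟨z, hz⟩ := exists_between hx.1
      exact (hleft z hz).trans (hpa z ⟨hz.1.le, (hz.2.trans hx.2).le⟩)
    obtain ⟨t, ht, hconst, hψ⟩ : ∃ t ∈ Icc a x, (∀ z ∈ Ioo t x, p z = y) ∧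
        psiFn a b x₀ p q y =
          alphaFn p q x₀ t + (t - y) * (1 - thetaFn p q x₀ t) := by
      rcases hya.eq_or_lt with rfl | hya
      · refine ⟨y, ⟨le_rfl, hx.1.le⟩, fun z hz ↦
          (hpa z ⟨hz.1.le, (hz.2.trans hx.2).le⟩).antisymm (hleft z hz), ?_⟩
        simp [psiFn, hab.le]
      · obtain ⟨ht, hlt⟩ := pRinv_spec hx hright
        refine ⟨_, ht, fun z hz ↦ le_antisymm ?_ (hleft z ⟨ht.1.trans_lt hz.1, hz.2⟩), ?_⟩
        · obtain ⟨w, hw, hwz, hyw⟩ := hlt z ⟨hz.1, (hz.2.trans hx.2).le⟩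
          exact (hp hw ⟨ht.1.trans hz.1.le, (hz.2.trans hx.2).le⟩ hwz.le).trans hyw
        · simp [psiFn, hya]
    have h := alphaFn_sub_of_lower_const hp hq hab hpa hqb hx₀
      ⟨ht.1, ht.2.trans hx.2.le⟩ hx' ht.2 hconst
    rw [LagFn, hψ, psiFn, deltaFn, if_neg hx.1.not_gt, if_pos hx.2.le, if_neg hx.1.not_gt,
      if_pos hx.2.le, abs_of_nonpos (by linarith [hx.1])]
    linear_combination h
end
end

section
/- Under the disjoint-support setup, assume that for every u ∈ (0,1) the supremum defining φ(u) is attained at P(u) ≤ a and Q(u) ≥ b with P(u) < F_η⁻¹(u) < Q(u), and that P and Q are measurable and nonincreasing. Let U and V be independent random variables, each uniformly distributed on (0,1). Define X = F_η⁻¹(U) and Y = P(U) if V ≤ (Q(U) − F_η⁻¹(U))/(Q(U) − P(U)), Y = Q(U) otherwise. Then X has law η and Y has law γ. -/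
open Set MeasureTheory ProbabilityTheory
open scoped ENNReal Classical

noncomputable section

/-- C_ζ(x) = ∫ (y − x)⁺ ζ(dy). -/
def Cfun (ζ : Measure ℝ) (x : ℝ) : ℝ := ∫ y, max (y - x) 0 ∂ζ

/-- D(x) = C_γ(x) − C_η(x). -/
def Dfun (η γ : Measure ℝ) (x : ℝ) : ℝ := Cfun γ x - Cfun η x

/-- Left-continuous quantile function F_η⁻¹(u) = inf {x : F_η(x) ≥ u}. -/
def Finv (η : Measure ℝ) (u : ℝ) : ℝ := sInf {x : ℝ | u ≤ (η (Iic x)).toReal}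

/-- ℰ_u(x) = D(F_η⁻¹(u)) + (x − F_η⁻¹(u))(γ_a − u) − D(x), where γ_a = γ((−∞,a]). -/
def Efun (η γ : Measure ℝ) (a u x : ℝ) : ℝ :=
  Dfun η γ (Finv η u) + (x - Finv η u) * ((γ (Iic a)).toReal - u) - Dfun η γ x

/-- φ(u) = sup over p̂ ≤ a, q̂ ≥ b with p̂ < F_η⁻¹(u) < q̂ of (ℰ_u(q̂) − D(p̂))/(q̂ − p̂). -/
def phiFn (η γ : Measure ℝ) (a b u : ℝ) : ℝ :=
  sSup {r : ℝ | ∃ pp qq : ℝ, pp ≤ a ∧ b ≤ qq ∧ pp < Finv η u ∧ Finv η u < qq ∧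
    r = (Efun η γ a u qq - Dfun η γ pp) / (qq - pp)}

/-- ζ(u) = γ_a − u − φ(u). -/
def zetaFn (η γ : Measure ℝ) (a b u : ℝ) : ℝ :=
  (γ (Iic a)).toReal - u - phiFn η γ a b u

/-- The attainment hypothesis: for u ∈ (0,1) the supremum defining φ(u) is attained at
P(u) ≤ a and Q(u) ≥ b with P(u) < F_η⁻¹(u) < Q(u). -/
def AttainsSup (η γ : Measure ℝ) (a b : ℝ) (P Q : ℝ → ℝ) : Prop :=
  ∀ u ∈ Ioo (0 : ℝ) 1,
    P u ≤ a ∧ b ≤ Q u ∧ P u < Finv η u ∧ Finv η u < Q u ∧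
    phiFn η γ a b u = (Efun η γ a u (Q u) - Dfun η γ (P u)) / (Q u - P u)

lemma volume_restrict_Ioo_Iic {r : ℝ} (h1 : r ≤ 1) :
    volume.restrict (Ioo (0 : ℝ) 1) (Iic r) = ENNReal.ofReal r := by
  rw [Measure.restrict_congr_set Ioo_ae_eq_Ioc, Measure.restrict_apply measurableSet_Iic,
    inter_comm, Ioc_inter_Iic, min_eq_right h1, Real.volume_Ioc, sub_zero]

section CallFunction

variable {ζ : Measure ℝ} [IsProbabilityMeasure ζ]

lemma integrable_max_sub (hζ : Integrable id ζ) (x : ℝ) :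
    Integrable (fun y => max (y - x) 0) ζ := by
  have h : Integrable (fun y : ℝ => y - x) ζ := hζ.sub (integrable_const x)
  exact h.pos_part

/-- Any `t` between `ζ((x, ∞))` and `ζ([x, ∞))` is minus a subgradient of `Cfun ζ` at `x`. -/
lemma Cfun_sub_mul_le (hζ : Integrable id ζ) {x t : ℝ} (h₁ : ζ.real (Ioi x) ≤ t)
    (h₂ : t ≤ ζ.real (Ici x)) (y : ℝ) : Cfun ζ x - (y - x) * t ≤ Cfun ζ y := by
  have key : ∀ s : Set ℝ, MeasurableSet s → Ioi x ⊆ s → s ⊆ Ici x →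
      Cfun ζ x - (y - x) * ζ.real s ≤ Cfun ζ y := by
    intro s hs h₁ h₂
    have hi : Integrable (s.indicator fun _ => y - x) ζ := (integrable_const _).indicator hs
    have : Cfun ζ x - (y - x) * ζ.real s =
        ∫ z, (max (z - x) 0 - s.indicator (fun _ => y - x) z) ∂ζ := by
      rw [integral_sub (integrable_max_sub hζ x) hi, integral_indicator_const _ hs, smul_eq_mul,
        mul_comm, Cfun]
    rw [this]
    refine integral_mono ((integrable_max_sub hζ x).sub hi) (integrable_max_sub hζ y) fun z => ?_
    simp only
    by_cases hz : z ∈ s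
    · have : x ≤ z := h₂ hz
      rw [indicator_of_mem hz, max_eq_left (by linarith)]
      exact le_trans (by linarith) (le_max_left _ _)
    · have : z ≤ x := not_lt.1 fun h => hz (h₁ h)
      rw [indicator_of_notMem hz, max_eq_right (by linarith), sub_zero]
      exact le_max_right _ _
  rcases le_total x y with h | h
  · have := key (Ioi x) measurableSet_Ioi subset_rfl Ioi_subset_Ici_self
    nlinarith
  · have := key (Ici x) measurableSet_Ici Ioi_subset_Ici_self subset_rfl
    nlinarith

lemma measureReal_Ioi_eq (x : ℝ) : ζ.real (Ioi x) = 1 - ζ.real (Iic x) := by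
  rw [← compl_Iic, probReal_compl_eq_one_sub measurableSet_Iic]

lemma measureReal_Ioi_le_Ici (x : ℝ) : ζ.real (Ioi x) ≤ ζ.real (Ici x) :=
  measureReal_mono Ioi_subset_Ici_self

lemma Cfun_cdf_le (hζ : Integrable id ζ) (x y : ℝ) :
    Cfun ζ x - (y - x) * (1 - ζ.real (Iic x)) ≤ Cfun ζ y :=
  Cfun_sub_mul_le hζ (measureReal_Ioi_eq x).le
    ((measureReal_Ioi_eq x).symm.le.trans (measureReal_Ioi_le_Ici x)) y

omit [IsProbabilityMeasure ζ] in
lemma Cfun_nonneg (x : ℝ) : 0 ≤ Cfun ζ x := integral_nonneg fun _ => le_max_right _ _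

lemma Cfun_antitone (hζ : Integrable id ζ) : Antitone (Cfun ζ) := fun x y h =>
  integral_mono (integrable_max_sub hζ y) (integrable_max_sub hζ x) fun z =>
    max_le_max (by linarith) le_rfl

lemma Cfun_eq_mean_sub (hζ : Integrable id ζ) {a b x : ℝ} (hs : ζ (Icc a b)ᶜ = 0) (hx : x ≤ a) :
    Cfun ζ x = (∫ y, y ∂ζ) - x := by
  have : Cfun ζ x = ∫ y, (y - x) ∂ζ := by
    refine integral_congr_ae ?_
    filter_upwards [measure_eq_zero_iff_ae_notMem.1 hs] with y hy
    have hy : y ∈ Icc a b := by simpa using hy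
    exact max_eq_left (by linarith [hy.1])
  rw [this, integral_sub (f := fun y : ℝ => y) hζ (integrable_const x)]
  simp

lemma mean_sub_le_Cfun (hζ : Integrable id ζ) (x : ℝ) : (∫ y, y ∂ζ) - x ≤ Cfun ζ x := by
  have : (∫ y, y ∂ζ) - x = ∫ y, (y - x) ∂ζ := by
    rw [integral_sub (f := fun y : ℝ => y) hζ (integrable_const x)]
    simp
  rw [this]
  exact integral_mono (hζ.sub (integrable_const x)) (integrable_max_sub hζ x) fun y =>
    le_max_left _ _

omit [IsProbabilityMeasure ζ] in
lemma Cfun_eq_zero {a b x : ℝ} (hs : ζ (Icc a b)ᶜ = 0) (hx : b ≤ x) : Cfun ζ x = 0 := by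
  refine integral_eq_zero_of_ae ?_
  filter_upwards [measure_eq_zero_iff_ae_notMem.1 hs] with y hy
  have hy : y ∈ Icc a b := by simpa using hy
  exact max_eq_right (by linarith [hy.2])

/-- `Cfun ζ` has slope `-(1 - ζ((-∞, a]))` on an interval whose interior carries no mass. -/
lemma Cfun_gap_le (hζ : Integrable id ζ) {a b x : ℝ} (hs : ζ (Ioo a b) = 0) (hx : x ∈ Icc a b)
    (y : ℝ) : Cfun ζ x - (y - x) * (1 - ζ.real (Iic a)) ≤ Cfun ζ y := by
  rw [← measureReal_Ioi_eq]
  refine Cfun_sub_mul_le hζ (measureReal_mono (Ioi_subset_Ioi hx.1)) ?_ y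
  have hsub : Ioi a ⊆ Ici x ∪ Ioo a b := fun z hz => by
    rcases le_or_gt x z with h | h
    · exact Or.inl h
    · exact Or.inr ⟨hz, h.trans_le hx.2⟩
  have := (measureReal_mono (μ := ζ) hsub).trans (measureReal_union_le _ _)
  rwa [measureReal_def (s := Ioo a b), hs, ENNReal.toReal_zero, add_zero] at this

lemma cdf_gap_eq {a b x : ℝ} (hs : ζ (Ioo a b) = 0) (hx : x ∈ Ico a b) :
    ζ.real (Iic x) = ζ.real (Iic a) := by
  refine le_antisymm ?_ (measureReal_mono (Iic_subset_Iic.2 hx.1))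
  have hsub : Iic x ⊆ Iic a ∪ Ioo a b := fun z hz => by
    rcases le_or_gt z a with h | h
    · exact Or.inl h
    · exact Or.inr ⟨h, lt_of_le_of_lt hz hx.2⟩
  have := (measureReal_mono (μ := ζ) hsub).trans (measureReal_union_le _ _)
  rwa [measureReal_def (s := Ioo a b), hs, ENNReal.toReal_zero, add_zero] at this

lemma le_cdf_of_forall_gt {x y c : ℝ} (hxy : x < y) (h : ∀ z ∈ Ioo x y, c ≤ ζ.real (Iic z)) :
    c ≤ ζ.real (Iic x) := by
  have hc := ((cdf ζ).right_continuous x).mono_left (nhdsWithin_mono x Ioi_subset_Ici_self)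
  rw [← cdf_eq_real]
  refine ge_of_tendsto hc ?_
  filter_upwards [Ioo_mem_nhdsGT hxy] with z hz
  rw [cdf_eq_real]
  exact h z hz

end CallFunction

section Quantile

variable {η : Measure ℝ} [IsProbabilityMeasure η] {u : ℝ}

lemma Finv_le_iff (hu : u ∈ Ioo (0 : ℝ) 1) (x : ℝ) : Finv η u ≤ x ↔ u ≤ η.real (Iic x) := by
  have hbdd : BddBelow {x : ℝ | u ≤ (η (Iic x)).toReal} := by
    obtain ⟨m, hm⟩ := ((tendsto_cdf_atBot η).eventually (gt_mem_nhds hu.1)).exists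
    refine ⟨m, fun y hy => le_of_not_gt fun h => ?_⟩
    rw [cdf_eq_real] at hm
    exact absurd (hm.trans_le hy) (not_lt.2 (measureReal_mono (Iic_subset_Iic.2 h.le)))
  have hne : {x : ℝ | u ≤ (η (Iic x)).toReal}.Nonempty := by
    obtain ⟨m, hm⟩ := ((tendsto_cdf_atTop η).eventually (lt_mem_nhds hu.2)).exists
    rw [cdf_eq_real] at hm
    exact ⟨m, hm.le⟩
  refine ⟨fun h => ?_, fun h => csInf_le hbdd h⟩
  refine le_cdf_of_forall_gt (lt_add_one x) fun z hz => ?_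
  obtain ⟨w, hw, hwz⟩ := exists_lt_of_csInf_lt hne (lt_of_le_of_lt h hz.1)
  exact le_trans hw (measureReal_mono (Iic_subset_Iic.2 hwz.le))

lemma Finv_mem_Icc {a b : ℝ} (hs : η (Icc a b)ᶜ = 0) (hu : u ∈ Ioo (0 : ℝ) 1) :
    Finv η u ∈ Icc a b := by
  constructor
  · refine le_of_not_gt fun h => ?_
    obtain ⟨z, hz, hza⟩ := exists_between h
    have h1 := (Finv_le_iff hu z).1 hz.le
    have h2 : η (Iic z) = 0 :=
      measure_mono_null (show Iic z ⊆ (Icc a b)ᶜ from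
      fun y (hy : y ≤ z) (hy' : y ∈ Icc a b) => by linarith [hy'.1]) hs
    rw [measureReal_def, h2, ENNReal.toReal_zero] at h1
    linarith [hu.1]
  · rw [Finv_le_iff hu]
    have h2 : η (Ioi b) = 0 :=
      measure_mono_null (show Ioi b ⊆ (Icc a b)ᶜ from
      fun y (hy : b < y) (hy' : y ∈ Icc a b) => by linarith [hy'.2]) hs
    have h3 := measureReal_Ioi_eq (ζ := η) b
    rw [measureReal_def, h2, ENNReal.toReal_zero] at h3
    linarith [hu.2]

lemma Cfun_Finv_le (hη : Integrable id η) (hu : u ∈ Ioo (0 : ℝ) 1) (x : ℝ) :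
    Cfun η (Finv η u) - (x - Finv η u) * (1 - u) ≤ Cfun η x := by
  refine Cfun_sub_mul_le hη ?_ ?_ x
  · rw [measureReal_Ioi_eq]
    linarith [(Finv_le_iff (η := η) hu _).1 le_rfl]
  · rw [← compl_Iio, probReal_compl_eq_one_sub measurableSet_Iio]
    have h : η.real (Iio (Finv η u)) ≤ u := by
      obtain ⟨s, hs, hlt, hlim⟩ := exists_seq_strictMono_tendsto (Finv η u)
      rw [← iUnion_Iic_eq_Iio_of_lt_of_tendsto hlt hlim, measureReal_def,
        Monotone.measure_iUnion fun m n hmn => Iic_subset_Iic.2 (hs.monotone hmn)]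
      refine ENNReal.toReal_le_of_le_ofReal hu.1.le (iSup_le fun n => ?_)
      have hn : η.real (Iic (s n)) < u := by
        have := hlt n
        rwa [← not_le, Finv_le_iff hu, not_le] at this
      rw [← ofReal_measureReal]
      exact ENNReal.ofReal_le_ofReal hn.le
    linarith

lemma measurable_indicator_Finv : Measurable ((Ioo (0 : ℝ) 1).indicator (Finv η)) := by
  refine measurable_of_Iic fun c => ?_
  have : (Ioo (0 : ℝ) 1).indicator (Finv η) ⁻¹' Iic c =
      (Ioo 0 1 ∩ Iic (η.real (Iic c))) ∪ ((Ioo 0 1)ᶜ ∩ {_u | 0 ≤ c}) := by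
    ext u
    by_cases hu : u ∈ Ioo (0 : ℝ) 1
    · simp only [mem_preimage, indicator_of_mem hu, mem_Iic, Finv_le_iff hu, mem_union, mem_inter_iff,
        mem_compl_iff, hu, not_true, true_and, false_and, or_false]
    · simp only [mem_preimage, indicator_of_notMem hu, mem_Iic, mem_union, mem_inter_iff,
        mem_compl_iff, hu, not_false_iff, true_and, false_and, false_or, mem_ofPred_eq]
  rw [this]
  exact (measurableSet_Ioo.inter measurableSet_Iic).union
    (measurableSet_Ioo.compl.inter (MeasurableSet.const _))

lemma map_Finv_uniform {Ω : Type*} [MeasurableSpace Ω] {Pr : Measure Ω} [IsProbabilityMeasure Pr]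
    {U : Ω → ℝ} (hU : Measurable U) (hUlaw : Pr.map U = volume.restrict (Ioo (0 : ℝ) 1)) :
    Pr.map (fun ω => Finv η (U ω)) = η := by
  have hae : (fun ω => Finv η (U ω)) =ᵐ[Pr] fun ω => (Ioo (0 : ℝ) 1).indicator (Finv η) (U ω) := by
    have : ∀ᵐ u ∂(Pr.map U), u ∈ Ioo (0 : ℝ) 1 := by
      rw [hUlaw]; exact ae_restrict_mem measurableSet_Ioo
    filter_upwards [ae_of_ae_map hU.aemeasurable this] with ω hω
    rw [indicator_of_mem hω]
  have hm := measurable_indicator_Finv (η := η)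
  rw [Measure.map_congr hae]
  have hmm : Measurable fun ω => (Ioo (0 : ℝ) 1).indicator (Finv η) (U ω) := hm.comp hU
  have := Measure.isProbabilityMeasure_map (μ := Pr) hmm.aemeasurable
  refine Measure.ext_of_Iic _ _ fun x => ?_
  have h1 := Measure.map_map (μ := Pr) hm hU
  rw [hUlaw] at h1
  change Pr.map ((Ioo (0 : ℝ) 1).indicator (Finv η) ∘ U) (Iic x) = _
  rw [← h1, Measure.map_apply hm measurableSet_Iic,
    Measure.restrict_apply (hm measurableSet_Iic)]
  have : (Ioo (0 : ℝ) 1).indicator (Finv η) ⁻¹' Iic x ∩ Ioo 0 1 =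
      Ioo 0 1 ∩ Iic (η.real (Iic x)) := by
    ext u
    refine ⟨fun h => ⟨h.2, ?_⟩, fun h => ⟨?_, h.1⟩⟩
    · have := h.1
      rw [mem_preimage, indicator_of_mem h.2] at this
      exact (Finv_le_iff h.2 x).1 this
    · rw [mem_preimage, indicator_of_mem h.1]
      exact (Finv_le_iff h.1 x).2 h.2
  rw [this, inter_comm, ← Measure.restrict_apply measurableSet_Iic,
    volume_restrict_Ioo_Iic measureReal_le_one, ofReal_measureReal]

end Quantile

section Convex

/-- A continuous function on `[α, β]` with subgradient `g` on `(α, β)` is a primitive of `g`. -/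
lemma integral_eq_sub_of_subgradient {f g : ℝ → ℝ} {α β : ℝ} (hf : ContinuousOn f (Icc α β))
    (hg : IntervalIntegrable g volume α β)
    (h : ∀ u ∈ Ioo α β, ∀ v ∈ Ioo α β, f u + g u * (v - u) ≤ f v)
    {s t : ℝ} (hs : α ≤ s) (hst : s ≤ t) (ht : t ≤ β) : ∫ u in s..t, g u = f t - f s := by
  have hmono : MonotoneOn g (Ioo α β) := by
    intro u hu v hv huv
    rcases huv.eq_or_lt with rfl | huv
    · exact le_rfl
    · have h1 := h u hu v hv
      have h2 := h v hv u hu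
      refine le_of_not_gt fun hlt => ?_
      nlinarith [mul_pos (sub_pos.2 hlt) (sub_pos.2 huv)]
  refine integral_eq_of_hasDerivAt_off_countable_of_le f g hst
    hmono.countable_not_continuousWithinAt (hf.mono (Icc_subset_Icc hs ht)) ?_
    (hg.mono_set ?_)
  swap
  · rw [uIcc_of_le hst, uIcc_of_le (hs.trans (hst.trans ht))]
    exact Icc_subset_Icc hs ht
  rintro x ⟨hx, hxc⟩
  have hx : x ∈ Ioo α β := ⟨hs.trans_lt hx.1, hx.2.trans_le ht⟩
  have hnhds : Ioo α β ∈ nhds x := Ioo_mem_nhds hx.1 hx.2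
  have hcont : ContinuousAt g x := by
    by_contra hc
    exact hxc ⟨hx, fun h' => hc (h'.continuousAt hnhds)⟩
  rw [hasDerivAt_iff_isLittleO, Asymptotics.isLittleO_iff]
  intro c hc
  filter_upwards [hnhds, Metric.continuousAt_iff'.1 hcont c hc] with v hv hvc
  have h1 := h x hx v hv
  have h2 := h v hv x hx
  rw [Real.dist_eq] at hvc
  rw [smul_eq_mul, Real.norm_eq_abs, Real.norm_eq_abs, abs_of_nonneg (by linarith)]
  calc f v - f x - (v - x) * g x ≤ (g v - g x) * (v - x) := by linarith
    _ ≤ |(g v - g x) * (v - x)| := le_abs_self _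
    _ = |g v - g x| * |v - x| := abs_mul _ _
    _ ≤ c * |v - x| := by gcongr

/-- Integral of the derivative `-w` of a strictly decreasing function over a sublevel set. -/
lemma integral_ite_sublevel {Φ w : ℝ → ℝ} (hΦ : ContinuousOn Φ (Icc 0 1))
    (hw : IntervalIntegrable w volume 0 1) (hpos : ∀ u ∈ Ioo (0 : ℝ) 1, 0 < w u)
    (hint : ∀ s t, 0 ≤ s → s ≤ t → t ≤ 1 → ∫ u in s..t, w u = Φ s - Φ t)
    {c : ℝ} (hc : c ∈ Icc (Φ 1) (Φ 0)) {A : ℝ → Prop} [DecidablePred A]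
    (hA : ∀ u ∈ Ioo (0 : ℝ) 1, A u → Φ u ≤ c) (hA' : ∀ u ∈ Ioo (0 : ℝ) 1, ¬ A u → c ≤ Φ u) :
    ∫ u in (0 : ℝ)..1, (if A u then w u else 0) = c - Φ 1 := by
  obtain ⟨s, hs, rfl⟩ := intermediate_value_Icc' zero_le_one hΦ hc
  have hanti : ∀ x ∈ Icc (0 : ℝ) 1, ∀ y ∈ Icc (0 : ℝ) 1, x < y → Φ y < Φ x := by
    intro x hx y hy hxy
    have h1 := hint x y hx.1 hxy.le hy.2
    have h2 : 0 < ∫ u in x..y, w u := by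
      refine intervalIntegral.intervalIntegral_pos_of_pos_on (hw.mono_set ?_)
        (fun u hu => hpos u ⟨hx.1.trans_lt hu.1, hu.2.trans_le hy.2⟩) hxy
      rw [uIcc_of_le hxy.le, uIcc_of_le zero_le_one]
      exact Icc_subset_Icc hx.1 hy.2
    linarith
  rw [← hint s 1 hs.1 hs.2 le_rfl, intervalIntegral.integral_of_le zero_le_one,
    intervalIntegral.integral_of_le hs.2, ← integral_indicator measurableSet_Ioc,
    ← integral_indicator measurableSet_Ioc]
  refine integral_congr_ae ?_
  have hne : ∀ x : ℝ, ∀ᵐ u : ℝ, u ≠ x := fun x => by simp [ae_iff]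
  filter_upwards [hne s, hne 1] with u hus hu1
  by_cases hu : u ∈ Ioo (0 : ℝ) 1
  · have huI : u ∈ Icc (0 : ℝ) 1 := Ioo_subset_Icc_self hu
    rw [indicator_of_mem (Ioo_subset_Ioc_self hu)]
    rcases lt_or_gt_of_ne hus with h | h
    · have hnA : ¬ A u := fun hAu => absurd (hanti u huI s hs h) (not_lt.2 (hA u hu hAu))
      rw [if_neg hnA, indicator_of_notMem fun h' => not_lt.2 h.le h'.1]
    · have hAu : A u := by
        by_contra hAu
        exact absurd (hanti s hs u huI h) (not_lt.2 (hA' u hu hAu))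
      rw [if_pos hAu, indicator_of_mem (show u ∈ Ioc s 1 from ⟨h, hu.2.le⟩)]
  · have hn : u ∉ Ioc (0 : ℝ) 1 := fun h => hu ⟨h.1, lt_of_le_of_ne h.2 hu1⟩
    rw [indicator_of_notMem hn, indicator_of_notMem fun h => hn ⟨hs.1.trans_lt h.1, h.2⟩]

end Convex

section Mixture

/-- Distribution function of the two-point randomization which picks `P U` with probability
`w U` and `Q U` otherwise. -/
lemma map_ite_uniform_Iic {Ω : Type*} [MeasurableSpace Ω] {Pr : Measure Ω} [IsProbabilityMeasure Pr]
    {U V : Ω → ℝ} (hU : Measurable U) (hV : Measurable V)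
    (hUlaw : Pr.map U = volume.restrict (Ioo (0 : ℝ) 1))
    (hVlaw : Pr.map V = volume.restrict (Ioo (0 : ℝ) 1)) (hUV : IndepFun U V Pr)
    {P Q w : ℝ → ℝ} (hP : Measurable P) (hQ : Measurable Q) (hw : Measurable w)
    (hw01 : ∀ u ∈ Ioo (0 : ℝ) 1, w u ∈ Icc (0 : ℝ) 1) (x : ℝ) :
    Pr.map (fun ω => if V ω ≤ w (U ω) then P (U ω) else Q (U ω)) (Iic x) =
      ENNReal.ofReal (∫ u in (0 : ℝ)..1,
        ((if P u ≤ x then w u else 0) + (if Q u ≤ x then 1 - w u else 0))) := by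
  set f : ℝ × ℝ → ℝ := fun p => if p.2 ≤ w p.1 then P p.1 else Q p.1 with hf
  have hfm : Measurable f := Measurable.ite
    (measurableSet_le measurable_snd (hw.comp measurable_fst))
    (hP.comp measurable_fst) (hQ.comp measurable_fst)
  have hjoint := (indepFun_iff_map_prod_eq_prod_map_map hU.aemeasurable hV.aemeasurable).1 hUV
  have h1 := Measure.map_map (μ := Pr) hfm (hU.prodMk hV)
  rw [hjoint, hUlaw, hVlaw] at h1
  change Pr.map (f ∘ fun ω => (U ω, V ω)) (Iic x) = _
  rw [← h1, Measure.map_apply hfm measurableSet_Iic, Measure.prod_apply (hfm measurableSet_Iic),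
    intervalIntegral.integral_of_le zero_le_one, integral_Ioc_eq_integral_Ioo]
  have hmeas : Measurable fun u =>
      ((if P u ≤ x then w u else 0) + (if Q u ≤ x then 1 - w u else 0)) :=
    (Measurable.ite (hP measurableSet_Iic) hw measurable_const).add
      (Measurable.ite (hQ measurableSet_Iic) (measurable_const.sub hw) measurable_const)
  have hbd : ∀ u ∈ Ioo (0 : ℝ) 1,
      0 ≤ ((if P u ≤ x then w u else 0) + (if Q u ≤ x then 1 - w u else 0)) ∧
      ((if P u ≤ x then w u else 0) + (if Q u ≤ x then 1 - w u else 0)) ≤ 1 := by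
    intro u hu
    obtain ⟨h0, h1⟩ := hw01 u hu
    split_ifs <;> constructor <;> linarith
  rw [ofReal_integral_eq_lintegral_ofReal]
  · refine setLIntegral_congr_fun measurableSet_Ioo fun u hu => ?_
    obtain ⟨h0, h1⟩ := hw01 u hu
    have hle : volume.restrict (Ioo (0 : ℝ) 1) {v | v ≤ w u} = ENNReal.ofReal (w u) :=
      volume_restrict_Ioo_Iic h1
    have hms : MeasurableSet {v : ℝ | v ≤ w u} := measurableSet_Iic
    have hun : volume.restrict (Ioo (0 : ℝ) 1) univ = 1 := by simp
    have hgt : volume.restrict (Ioo (0 : ℝ) 1) {v | v ≤ w u}ᶜ = ENNReal.ofReal (1 - w u) := by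
      rw [measure_compl hms (by rw [hle]; exact ENNReal.ofReal_ne_top), hle, hun,
        ENNReal.ofReal_sub _ h0, ENNReal.ofReal_one]
    by_cases hPx : P u ≤ x <;> by_cases hQx : Q u ≤ x
    · have : Prod.mk u ⁻¹' (f ⁻¹' Iic x) = univ := by
        ext v
        by_cases hv : v ≤ w u <;> simp [hf, hv, hPx, hQx]
      simp [this, hPx, hQx]
    · have : Prod.mk u ⁻¹' (f ⁻¹' Iic x) = {v | v ≤ w u} := by
        ext v
        by_cases hv : v ≤ w u <;> simp [hf, hv, hPx, hQx]
      simp only [this, hle, hPx, hQx, if_true, if_false, add_zero]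
    · have : Prod.mk u ⁻¹' (f ⁻¹' Iic x) = {v | v ≤ w u}ᶜ := by
        ext v
        by_cases hv : v ≤ w u <;> simp [hf, hv, hPx, hQx]
      simp only [this, hgt, hPx, hQx, if_true, if_false, zero_add]
    · have : Prod.mk u ⁻¹' (f ⁻¹' Iic x) = ∅ := by
        ext v
        by_cases hv : v ≤ w u <;> simp [hf, hv, hPx, hQx]
      simp only [this, measure_empty, ENNReal.ofReal_zero, hPx, hQx, if_false, add_zero]
  · refine Measure.integrableOn_of_bounded (M := 1) (by simp) hmeas.aestronglyMeasurable ?_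
    filter_upwards [ae_restrict_mem measurableSet_Ioo] with u hu
    rw [Real.norm_eq_abs, abs_of_nonneg (hbd u hu).1]
    exact (hbd u hu).2
  · filter_upwards [ae_restrict_mem measurableSet_Ioo] with u hu
    exact (hbd u hu).1

end Mixture

lemma nonneg_of_forall_le_mul {K M c : ℝ} (h : ∀ t, M ≤ t → K ≤ c * t) : 0 ≤ c := by
  by_contra! hc
  have h1 := h _ (le_max_left M ((|K| + 1) / -c))
  have h2 : (|K| + 1) / -c ≤ max M ((|K| + 1) / -c) := le_max_right _ _
  rw [div_le_iff₀ (by linarith)] at h2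
  linarith [neg_abs_le K]

section DisjointSupport

variable {a b : ℝ} {η γ : Measure ℝ} [IsProbabilityMeasure η] [IsProbabilityMeasure γ]

lemma Dfun_left_le (hη : Integrable id η) (hγ : Integrable id γ) (hs : η (Icc a b)ᶜ = 0)
    {x y : ℝ} (hx : x ≤ a) (hy : y ≤ a) :
    Dfun η γ x + (y - x) * γ.real (Iic x) ≤ Dfun η γ y := by
  have := Cfun_cdf_le hγ x y
  rw [Dfun, Dfun, Cfun_eq_mean_sub hη hs hx, Cfun_eq_mean_sub hη hs hy]
  linarith

omit [IsProbabilityMeasure η] in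
lemma Dfun_right_le (hγ : Integrable id γ) (hs : η (Icc a b)ᶜ = 0)
    {x y : ℝ} (hx : b ≤ x) (hy : b ≤ y) :
    Dfun η γ x - (y - x) * (1 - γ.real (Iic x)) ≤ Dfun η γ y := by
  have := Cfun_cdf_le hγ x y
  rw [Dfun, Dfun, Cfun_eq_zero hs hx, Cfun_eq_zero hs hy]
  linarith

lemma Dfun_le_of_le_left (hη : Integrable id η) (hγ : Integrable id γ) (hs : η (Icc a b)ᶜ = 0)
    {p : ℝ} (hp : p ≤ a) : Dfun η γ p ≤ Dfun η γ a := by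
  have h := Dfun_left_le hη hγ hs hp le_rfl
  nlinarith [measureReal_nonneg (μ := γ) (s := Iic p)]

omit [IsProbabilityMeasure η] in
lemma Dfun_le_of_le_right (hγ : Integrable id γ) (hs : η (Icc a b)ᶜ = 0)
    {q : ℝ} (hq : b ≤ q) : Dfun η γ q ≤ Dfun η γ b := by
  rw [Dfun, Dfun, Cfun_eq_zero hs le_rfl, Cfun_eq_zero hs hq]
  linarith [Cfun_antitone hγ hq]

omit [IsProbabilityMeasure η] [IsProbabilityMeasure γ] in
lemma Efun_eq (u x : ℝ) : Efun η γ a u x =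
    Dfun η γ (Finv η u) + (x - Finv η u) * (γ.real (Iic a) - u) - Dfun η γ x := rfl

variable {u : ℝ}

/-- The tangent to `Dfun η γ` at `Finv η u` dominates it on `[a, b]`. -/
lemma Dfun_le_tangent (hη : Integrable id η) (hγ : Integrable id γ)
    (hgap : γ (Ioo a b) = 0) (hu : u ∈ Ioo (0 : ℝ) 1) {x : ℝ} (hx : x ∈ Icc a b) :
    Dfun η γ x ≤ Dfun η γ (Finv η u) + (x - Finv η u) * (γ.real (Iic a) - u) := by
  have h1 := Cfun_gap_le hγ hgap hx (Finv η u)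
  have h2 := Cfun_Finv_le hη hu x
  rw [Dfun, Dfun]
  linarith

lemma Efun_sub_le_mass (hη : Integrable id η) (hγ : Integrable id γ) (hs : η (Icc a b)ᶜ = 0)
    (hgap : γ (Ioo a b) = 0) (hC : ∀ x, Cfun η x ≤ Cfun γ x) (hu : u ∈ Ioo (0 : ℝ) 1)
    {p q : ℝ} (hp : p ≤ a) (hq : Finv η u < q) :
    Efun η γ a u q - Dfun η γ p ≤ γ.real (Iic a) * (q - p) := by
  have h1 := Cfun_gap_le hγ hgap (Finv_mem_Icc hs hu) p
  have h2 := mean_sub_le_Cfun hη (Finv η u)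
  have h3 := Cfun_eq_mean_sub hη hs hp
  have h4 : 0 ≤ Dfun η γ q := sub_nonneg.2 (hC q)
  have h5 : Dfun η γ (Finv η u) - Dfun η γ p ≤ (Finv η u - p) * γ.real (Iic a) := by
    rw [Dfun, Dfun]
    linarith
  rw [Efun_eq]
  nlinarith [mul_nonneg hu.1.le (sub_nonneg.2 hq.le)]

lemma Efun_sub_le_one_sub (hγ : Integrable id γ) (hs : η (Icc a b)ᶜ = 0)
    (hgap : γ (Ioo a b) = 0) (hC : ∀ x, Cfun η x ≤ Cfun γ x) (hu : u ∈ Ioo (0 : ℝ) 1)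
    {p q : ℝ} (hbq : b ≤ q) (hp : p < Finv η u) :
    Efun η γ a u q - Dfun η γ p ≤ (1 - u) * (q - p) := by
  have h1 := Cfun_gap_le hγ hgap (Finv_mem_Icc hs hu) q
  have h2 := Cfun_nonneg (ζ := η) (Finv η u)
  have h3 := Cfun_eq_zero hs hbq
  have h4 : 0 ≤ Dfun η γ p := sub_nonneg.2 (hC p)
  have h5 : Dfun η γ (Finv η u) - Dfun η γ q ≤ (q - Finv η u) * (1 - γ.real (Iic a)) := by
    rw [Dfun, Dfun]
    linarith
  rw [Efun_eq]
  nlinarith [mul_nonneg (sub_nonneg.2 hu.2.le) (sub_nonneg.2 hp.le)]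

lemma Efun_sub_le_phiFn_mul (hη : Integrable id η) (hγ : Integrable id γ)
    (hs : η (Icc a b)ᶜ = 0) (hgap : γ (Ioo a b) = 0) (hC : ∀ x, Cfun η x ≤ Cfun γ x)
    (hu : u ∈ Ioo (0 : ℝ) 1) {p q : ℝ} (hpa : p ≤ a) (hbq : b ≤ q) (hp : p < Finv η u)
    (hq : Finv η u < q) :
    Efun η γ a u q - Dfun η γ p ≤ phiFn η γ a b u * (q - p) := by
  rw [← div_le_iff₀ (by linarith)]
  refine le_csSup ⟨γ.real (Iic a), ?_⟩ ⟨p, q, hpa, hbq, hp, hq, rfl⟩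
  rintro r ⟨p', q', hp'a, -, hp', hq', rfl⟩
  rw [div_le_iff₀ (by linarith)]
  exact Efun_sub_le_mass hη hγ hs hgap hC hu hp'a hq'

omit [IsProbabilityMeasure γ] in
lemma phiFn_le (hs : η (Icc a b)ᶜ = 0) (hu : u ∈ Ioo (0 : ℝ) 1) {c : ℝ}
    (h : ∀ p q, p ≤ a → b ≤ q → p < Finv η u → Finv η u < q →
      Efun η γ a u q - Dfun η γ p ≤ c * (q - p)) : phiFn η γ a b u ≤ c := by
  have hG := Finv_mem_Icc hs hu
  refine csSup_le ⟨_, a - 1, b + 1, by linarith, by linarith, by linarith [hG.1],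
    by linarith [hG.2], rfl⟩ ?_
  rintro r ⟨p, q, hpa, hbq, hp, hq, rfl⟩
  rw [div_le_iff₀ (by linarith)]
  exact h p q hpa hbq hp hq

lemma phiFn_nonneg (hη : Integrable id η) (hγ : Integrable id γ) (hs : η (Icc a b)ᶜ = 0)
    (hgap : γ (Ioo a b) = 0) (hC : ∀ x, Cfun η x ≤ Cfun γ x) (hu : u ∈ Ioo (0 : ℝ) 1) :
    0 ≤ phiFn η γ a b u := by
  have hG := Finv_mem_Icc hs hu
  refine nonneg_of_forall_le_mul (K := Efun η γ a u (b + 1) - Dfun η γ a) (M := b - a + 2)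
    fun t ht => ?_
  have h := Efun_sub_le_phiFn_mul hη hγ hs hgap hC hu (p := b + 1 - t) (q := b + 1)
    (by linarith) (by linarith) (by linarith [hG.1]) (by linarith [hG.2])
  have h2 := Dfun_le_of_le_left hη hγ hs (p := b + 1 - t) (by linarith)
  rw [sub_sub_cancel] at h
  linarith

lemma sub_le_phiFn (hη : Integrable id η) (hγ : Integrable id γ) (hs : η (Icc a b)ᶜ = 0)
    (hgap : γ (Ioo a b) = 0) (hC : ∀ x, Cfun η x ≤ Cfun γ x) (hu : u ∈ Ioo (0 : ℝ) 1) :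
    γ.real (Iic a) - u ≤ phiFn η γ a b u := by
  have hG := Finv_mem_Icc hs hu
  rw [← sub_nonneg]
  refine nonneg_of_forall_le_mul (M := b - a + 2)
    (K := Dfun η γ (Finv η u) + (a - 1 - Finv η u) * (γ.real (Iic a) - u) - Dfun η γ b -
      Dfun η γ (a - 1)) fun t ht => ?_
  have h := Efun_sub_le_phiFn_mul hη hγ hs hgap hC hu (p := a - 1) (q := a - 1 + t)
    (by linarith) (by linarith) (by linarith [hG.1]) (by linarith [hG.2])
  have h2 := Dfun_le_of_le_right hγ hs (q := a - 1 + t) (by linarith)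
  rw [Efun_eq, add_sub_cancel_left] at h
  linarith

/-- The bound defining `phiFn` extends to the degenerate positions of `p` and `q`. -/
lemma Efun_sub_le_phiFn_mul_of_lt (hη : Integrable id η) (hγ : Integrable id γ)
    (hs : η (Icc a b)ᶜ = 0) (hgap : γ (Ioo a b) = 0) (hC : ∀ x, Cfun η x ≤ Cfun γ x)
    (hu : u ∈ Ioo (0 : ℝ) 1) {p q : ℝ} (hpa : p ≤ a) (hbq : b ≤ q) (hpq : p < q) :
    Efun η γ a u q - Dfun η γ p ≤ phiFn η γ a b u * (q - p) := by
  have hG := Finv_mem_Icc hs hu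
  rcases (hpa.trans hG.1).eq_or_lt with h | hp
  · have h1 := sub_le_phiFn hη hγ hs hgap hC hu
    have h2 : 0 ≤ Dfun η γ q := sub_nonneg.2 (hC q)
    rw [Efun_eq, ← h]
    nlinarith
  rcases (hG.2.trans hbq).eq_or_lt with h | hq
  · have h1 := phiFn_nonneg hη hγ hs hgap hC hu
    have h2 : 0 ≤ Dfun η γ p := sub_nonneg.2 (hC p)
    rw [Efun_eq, ← h] at *
    nlinarith
  · exact Efun_sub_le_phiFn_mul hη hγ hs hgap hC hu hpa hbq hp hq

variable {P Q : ℝ → ℝ}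

omit [IsProbabilityMeasure η] [IsProbabilityMeasure γ] in
lemma AttainsSup.eq_mul (hPQ : AttainsSup η γ a b P Q) (hu : u ∈ Ioo (0 : ℝ) 1) :
    Efun η γ a u (Q u) - Dfun η γ (P u) = phiFn η γ a b u * (Q u - P u) := by
  obtain ⟨-, -, hP, hQ, h⟩ := hPQ u hu
  rw [h, div_mul_cancel₀]
  linarith

/-- Envelope theorem: minus the weight of `P u` is a subgradient of `phiFn` at `u`. -/
lemma AttainsSup.subgradient (hPQ : AttainsSup η γ a b P Q) (hη : Integrable id η)
    (hγ : Integrable id γ) (hs : η (Icc a b)ᶜ = 0) (hgap : γ (Ioo a b) = 0)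
    (hC : ∀ x, Cfun η x ≤ Cfun γ x) (hu : u ∈ Ioo (0 : ℝ) 1) {v : ℝ} (hv : v ∈ Ioo (0 : ℝ) 1) :
    phiFn η γ a b u + -((Q u - Finv η u) / (Q u - P u)) * (v - u) ≤ phiFn η γ a b v := by
  obtain ⟨hPa, hbQ, hP, hQ, -⟩ := hPQ u hu
  have hd : 0 < Q u - P u := by linarith
  have h1 := hPQ.eq_mul hu
  have h2 := Efun_sub_le_phiFn_mul_of_lt hη hγ hs hgap hC hv hPa hbQ (by linarith)
  have h3 := Dfun_le_tangent hη hγ hgap hv (Finv_mem_Icc hs hu)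
  rw [Efun_eq] at h1 h2
  have h4 : (phiFn η γ a b u * (Q u - P u) - (Q u - Finv η u) * (v - u)) / (Q u - P u) ≤
      phiFn η γ a b v := by
    rw [div_le_iff₀ hd]
    linarith
  convert h4 using 1
  field_simp
  ring

lemma AttainsSup.phiFn_le_of_le (hPQ : AttainsSup η γ a b P Q) (hη : Integrable id η)
    (hγ : Integrable id γ) (hs : η (Icc a b)ᶜ = 0) (hgap : γ (Ioo a b) = 0)
    (hC : ∀ x, Cfun η x ≤ Cfun γ x) (hu : u ∈ Ioo (0 : ℝ) 1) {x : ℝ} (hx : x < a)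
    (h : P u ≤ x) : phiFn η γ a b u ≤ γ.real (Iic x) := by
  refine le_cdf_of_forall_gt hx fun z hz => ?_
  obtain ⟨-, hbQ, -, hQ, -⟩ := hPQ u hu
  have h1 := hPQ.eq_mul hu
  have h2 := Efun_sub_le_phiFn_mul hη hγ hs hgap hC hu hz.2.le hbQ
    (hz.2.trans_le (Finv_mem_Icc hs hu).1) hQ
  have h3 := Dfun_left_le hη hγ hs hz.2.le (h.trans hx.le)
  have h4 : 0 < z - P u := by linarith [hz.1]
  nlinarith

lemma AttainsSup.le_phiFn_of_lt (hPQ : AttainsSup η γ a b P Q) (hη : Integrable id η)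
    (hγ : Integrable id γ) (hs : η (Icc a b)ᶜ = 0) (hgap : γ (Ioo a b) = 0)
    (hC : ∀ x, Cfun η x ≤ Cfun γ x) (hu : u ∈ Ioo (0 : ℝ) 1) {x : ℝ}
    (h : x < P u) : γ.real (Iic x) ≤ phiFn η γ a b u := by
  obtain ⟨hPa, hbQ, hP, hQ, -⟩ := hPQ u hu
  have h1 := hPQ.eq_mul hu
  have h2 := Efun_sub_le_phiFn_mul hη hγ hs hgap hC hu (h.le.trans hPa) hbQ (h.trans hP) hQ
  have h3 := Dfun_left_le hη hγ hs (h.le.trans hPa) hPa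
  have h4 : 0 < P u - x := by linarith
  nlinarith

lemma AttainsSup.zetaFn_le_of_le (hPQ : AttainsSup η γ a b P Q) (hη : Integrable id η)
    (hγ : Integrable id γ) (hs : η (Icc a b)ᶜ = 0) (hgap : γ (Ioo a b) = 0)
    (hC : ∀ x, Cfun η x ≤ Cfun γ x) (hu : u ∈ Ioo (0 : ℝ) 1) {x : ℝ} (h : Q u ≤ x) :
    zetaFn η γ a b u ≤ γ.real (Iic x) - 1 := by
  suffices zetaFn η γ a b u + 1 ≤ γ.real (Iic x) by linarith
  refine le_cdf_of_forall_gt (lt_add_one x) fun z hz => ?_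
  obtain ⟨hPa, hbQ, hP, hQ, -⟩ := hPQ u hu
  have h0 : Q u < z := h.trans_lt hz.1
  have h1 := hPQ.eq_mul hu
  have h2 := Efun_sub_le_phiFn_mul hη hγ hs hgap hC hu hPa (hbQ.trans h0.le) hP (hQ.trans h0)
  have h3 := Dfun_right_le hγ hs (hbQ.trans h0.le) hbQ
  have h4 : 0 < z - Q u := by linarith
  rw [Efun_eq] at h1 h2
  change γ.real (Iic a) - u - phiFn η γ a b u + 1 ≤ _
  nlinarith

lemma AttainsSup.le_zetaFn_of_lt (hPQ : AttainsSup η γ a b P Q) (hη : Integrable id η)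
    (hγ : Integrable id γ) (hs : η (Icc a b)ᶜ = 0) (hgap : γ (Ioo a b) = 0)
    (hC : ∀ x, Cfun η x ≤ Cfun γ x) (hu : u ∈ Ioo (0 : ℝ) 1) {x : ℝ} (hx : b ≤ x)
    (h : x < Q u) : γ.real (Iic x) - 1 ≤ zetaFn η γ a b u := by
  obtain ⟨hPa, hbQ, hP, hQ, -⟩ := hPQ u hu
  obtain ⟨z, hxz, hzQ⟩ := exists_between h
  have hbz : b < z := hx.trans_lt hxz
  have h1 := hPQ.eq_mul hu
  have h2 := Efun_sub_le_phiFn_mul hη hγ hs hgap hC hu hPa hbz.le hP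
    ((Finv_mem_Icc hs hu).2.trans_lt hbz)
  have h3 := Dfun_right_le hγ hs hbz.le hbQ
  have h4 : 0 < Q u - z := by linarith
  have h5 : γ.real (Iic x) ≤ γ.real (Iic z) := measureReal_mono (Iic_subset_Iic.2 hxz.le)
  rw [Efun_eq] at h1 h2
  change _ ≤ γ.real (Iic a) - u - phiFn η γ a b u
  nlinarith

end DisjointSupport

section Embedding

variable {a b : ℝ} {η γ : Measure ℝ} [IsProbabilityMeasure η] [IsProbabilityMeasure γ]
  {P Q : ℝ → ℝ}

omit [IsProbabilityMeasure η] [IsProbabilityMeasure γ] in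
lemma AttainsSup.weight_mem_Ioo (hPQ : AttainsSup η γ a b P Q) {u : ℝ} (hu : u ∈ Ioo (0 : ℝ) 1) :
    (Q u - Finv η u) / (Q u - P u) ∈ Ioo (0 : ℝ) 1 := by
  obtain ⟨-, -, hP, hQ, -⟩ := hPQ u hu
  exact ⟨div_pos (by linarith) (by linarith), (div_lt_one (by linarith)).2 (by linarith)⟩

/-- `phiFn` extends continuously to `[0, 1]` with boundary values `γ((-∞, a])` and `0`. -/
lemma AttainsSup.exists_continuousOn_extension (hPQ : AttainsSup η γ a b P Q)
    (hη : Integrable id η) (hγ : Integrable id γ) (hs : η (Icc a b)ᶜ = 0)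
    (hgap : γ (Ioo a b) = 0) (hC : ∀ x, Cfun η x ≤ Cfun γ x) :
    ∃ Φ : ℝ → ℝ, ContinuousOn Φ (Icc 0 1) ∧ (∀ u ∈ Ioo (0 : ℝ) 1, Φ u = phiFn η γ a b u) ∧
      Φ 0 = γ.real (Iic a) ∧ Φ 1 = 0 := by
  have hlip : ∀ u ∈ Ioo (0 : ℝ) 1, ∀ v ∈ Ioo (0 : ℝ) 1,
      phiFn η γ a b u - phiFn η γ a b v ≤ |v - u| := by
    intro u hu v hv
    have h := hPQ.subgradient hη hγ hs hgap hC hu hv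
    obtain ⟨h0, h1⟩ := hPQ.weight_mem_Ioo hu
    calc phiFn η γ a b u - phiFn η γ a b v
        ≤ (Q u - Finv η u) / (Q u - P u) * (v - u) := by linarith
      _ ≤ (Q u - Finv η u) / (Q u - P u) * |v - u| := by gcongr; exact le_abs_self _
      _ ≤ 1 * |v - u| := by gcongr
      _ = |v - u| := one_mul _
  have hcont : ContinuousOn (phiFn η γ a b) (Ioo 0 1) := by
    refine (LipschitzOnWith.of_dist_le_mul (K := 1) fun u hu v hv => ?_).continuousOn
    rw [Real.dist_eq, Real.dist_eq, NNReal.coe_one, one_mul, abs_le]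
    have h1 := hlip u hu v hv
    have h2 := hlip v hv u hu
    rw [abs_sub_comm] at h1
    constructor <;> linarith
  have h0 : Filter.Tendsto (phiFn η γ a b) (nhdsWithin 0 (Ioi 0)) (nhds (γ.real (Iic a))) := by
    have hl : Filter.Tendsto (fun u : ℝ => γ.real (Iic a) - u) (nhdsWithin 0 (Ioi 0))
        (nhds (γ.real (Iic a))) := by
      have : ContinuousAt (fun u : ℝ => γ.real (Iic a) - u) 0 := by fun_prop
      simpa using this.tendsto.mono_left nhdsWithin_le_nhds
    refine tendsto_of_tendsto_of_tendsto_of_le_of_le' hl tendsto_const_nhds ?_ ?_ <;>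
      filter_upwards [Ioo_mem_nhdsGT zero_lt_one] with u hu
    · exact sub_le_phiFn hη hγ hs hgap hC hu
    · exact phiFn_le hs hu fun p q hp _ _ hq => Efun_sub_le_mass hη hγ hs hgap hC hu hp hq
  have h1 : Filter.Tendsto (phiFn η γ a b) (nhdsWithin 1 (Iio 1)) (nhds 0) := by
    have hr : Filter.Tendsto (fun u : ℝ => 1 - u) (nhdsWithin 1 (Iio 1)) (nhds 0) := by
      have : ContinuousAt (fun u : ℝ => 1 - u) 1 := by fun_prop
      simpa using this.tendsto.mono_left nhdsWithin_le_nhds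
    refine tendsto_of_tendsto_of_tendsto_of_le_of_le' tendsto_const_nhds hr ?_ ?_ <;>
      filter_upwards [Ioo_mem_nhdsLT zero_lt_one] with u hu
    · exact phiFn_nonneg hη hγ hs hgap hC hu
    · exact phiFn_le hs hu fun p q _ hq hp _ => Efun_sub_le_one_sub hγ hs hgap hC hu hq hp
  exact ⟨extendFrom (Ioo 0 1) (phiFn η γ a b),
    continuousOn_Icc_extendFrom_Ioo hcont h0 h1,
    extendFrom_extends hcont, eq_lim_at_left_extendFrom_Ioo zero_lt_one h0,
    eq_lim_at_right_extendFrom_Ioo zero_lt_one h1⟩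

lemma AttainsSup.integral_eq_cdf (hPQ : AttainsSup η γ a b P Q)
    (hη : Integrable id η) (hγ : Integrable id γ) (hs : η (Icc a b)ᶜ = 0)
    (hgap : γ (Ioo a b) = 0) (hC : ∀ x, Cfun η x ≤ Cfun γ x)
    (hP : Measurable P) (hQ : Measurable Q) {w : ℝ → ℝ} (hwm : Measurable w)
    (hw : ∀ u ∈ Ioo (0 : ℝ) 1, w u = (Q u - Finv η u) / (Q u - P u)) (x : ℝ) :
    ∫ u in (0 : ℝ)..1, ((if P u ≤ x then w u else 0) + (if Q u ≤ x then 1 - w u else 0)) =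
      γ.real (Iic x) := by
  obtain ⟨Φ, hΦ, hΦφ, hΦ0, hΦ1⟩ := hPQ.exists_continuousOn_extension hη hγ hs hgap hC
  have hw01 : ∀ u ∈ Ioo (0 : ℝ) 1, w u ∈ Ioo (0 : ℝ) 1 := fun u hu => by
    rw [hw u hu]; exact hPQ.weight_mem_Ioo hu
  have hbdd : ∀ f : ℝ → ℝ, Measurable f → (∀ u ∈ Ioo (0 : ℝ) 1, |f u| ≤ 1) →
      IntervalIntegrable f volume 0 1 := by
    intro f hf h
    rw [intervalIntegrable_iff_integrableOn_Ioo_of_le zero_le_one]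
    refine Measure.integrableOn_of_bounded (M := 1) (by simp) hf.aestronglyMeasurable ?_
    filter_upwards [ae_restrict_mem measurableSet_Ioo] with u hu using h u hu
  have hwi : IntervalIntegrable w volume 0 1 := hbdd w hwm fun u hu => by
    rw [abs_of_pos (hw01 u hu).1]; exact (hw01 u hu).2.le
  have hint : ∀ s t, 0 ≤ s → s ≤ t → t ≤ 1 → ∫ u in s..t, w u = Φ s - Φ t := by
    intro s t h0 hst h1
    have h := integral_eq_sub_of_subgradient (g := fun u => -w u) hΦ hwi.neg
      (fun u hu v hv => by
        rw [hΦφ u hu, hΦφ v hv, hw u hu]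
        exact hPQ.subgradient hη hγ hs hgap hC hu hv) h0 hst h1
    rw [intervalIntegral.integral_neg] at h
    linarith
  have hmass : ∀ u ∈ Ioo (0 : ℝ) 1, phiFn η γ a b u ≤ γ.real (Iic a) := fun u hu =>
    phiFn_le hs hu fun p q hp _ _ hq => Efun_sub_le_mass hη hγ hs hgap hC hu hp hq
  have hone : ∀ u ∈ Ioo (0 : ℝ) 1, phiFn η γ a b u ≤ 1 - u := fun u hu =>
    phiFn_le hs hu fun p q _ hq hp _ => Efun_sub_le_one_sub hγ hs hgap hC hu hq hp
  have hP_int : ∫ u in (0 : ℝ)..1, (if P u ≤ x then w u else 0) =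
      min (γ.real (Iic x)) (γ.real (Iic a)) := by
    rw [integral_ite_sublevel hΦ hwi (fun u hu => (hw01 u hu).1) hint (A := fun u => P u ≤ x)
      (c := min (γ.real (Iic x)) (γ.real (Iic a))), hΦ1, sub_zero]
    · rw [hΦ0, hΦ1]
      exact ⟨le_min measureReal_nonneg measureReal_nonneg, min_le_right _ _⟩
    · intro u hu h
      rw [hΦφ u hu]
      refine le_min ?_ (hmass u hu)
      rcases lt_or_ge x a with hx | hx
      · exact hPQ.phiFn_le_of_le hη hγ hs hgap hC hu hx h
      · exact (hmass u hu).trans (measureReal_mono (Iic_subset_Iic.2 hx))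
    · intro u hu h
      rw [hΦφ u hu]
      exact (min_le_left _ _).trans (hPQ.le_phiFn_of_lt hη hγ hs hgap hC hu (not_le.1 h))
  have hQ_int : ∫ u in (0 : ℝ)..1, (if Q u ≤ x then 1 - w u else 0) =
      max (γ.real (Iic x)) (γ.real (Iic a)) - γ.real (Iic a) := by
    have hZ : ∀ u ∈ Ioo (0 : ℝ) 1, γ.real (Iic a) - u - Φ u = zetaFn η γ a b u := fun u hu => by
      rw [hΦφ u hu]; rfl
    rw [integral_ite_sublevel (Φ := fun u => γ.real (Iic a) - u - Φ u) (w := fun u => 1 - w u)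
      ((continuousOn_const.sub continuousOn_id).sub hΦ) (intervalIntegrable_const.sub hwi)
      (fun u hu => sub_pos.2 (hw01 u hu).2) ?_ (A := fun u => Q u ≤ x)
      (c := max (γ.real (Iic x)) (γ.real (Iic a)) - 1)]
    · rw [hΦ1]; ring
    · rw [hΦ0, hΦ1]
      have h1 : max (γ.real (Iic x)) (γ.real (Iic a)) ≤ 1 :=
        max_le measureReal_le_one measureReal_le_one
      have h2 := le_max_right (γ.real (Iic x)) (γ.real (Iic a))
      constructor <;> linarith
    · intro u hu h
      rw [hZ u hu]
      linarith [hPQ.zetaFn_le_of_le hη hγ hs hgap hC hu h,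
        le_max_left (γ.real (Iic x)) (γ.real (Iic a))]
    · intro u hu h
      have h1 : γ.real (Iic a) ≤ zetaFn η γ a b u + 1 := by
        change _ ≤ γ.real (Iic a) - u - phiFn η γ a b u + 1
        linarith [hone u hu]
      rw [hZ u hu, sub_le_iff_le_add]
      refine max_le ?_ h1
      rcases lt_or_ge x b with hx | hx
      · refine le_trans ?_ h1
        rcases le_total a x with hax | hax
        · exact (cdf_gap_eq hgap ⟨hax, hx⟩).le
        · exact measureReal_mono (Iic_subset_Iic.2 hax)
      · linarith [hPQ.le_zetaFn_of_lt hη hγ hs hgap hC hu hx (not_le.1 h)]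
    · intro s t h0 hst h1
      have hwst : IntervalIntegrable w volume s t := hwi.mono_set (by
        rw [uIcc_of_le hst, uIcc_of_le zero_le_one]; exact Icc_subset_Icc h0 h1)
      rw [intervalIntegral.integral_sub intervalIntegrable_const hwst, hint s t h0 hst h1,
        intervalIntegral.integral_const, smul_eq_mul]
      ring
  rw [intervalIntegral.integral_add, hP_int, hQ_int]
  · linarith [min_add_max (γ.real (Iic x)) (γ.real (Iic a))]
  · refine hbdd _ (Measurable.ite (hP measurableSet_Iic) hwm measurable_const) fun u hu => ?_
    obtain ⟨h0, h1⟩ := hw01 u hu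
    rw [abs_le]
    split_ifs <;> constructor <;> linarith
  · refine hbdd _ (Measurable.ite (hQ measurableSet_Iic) (measurable_const.sub hwm)
      measurable_const) fun u hu => ?_
    obtain ⟨h0, h1⟩ := hw01 u hu
    rw [abs_le]
    split_ifs <;> constructor <;> linarith

end Embedding

theorem stmt7 (a b : ℝ) (hab : a < b) (η γ : Measure ℝ)
    [IsProbabilityMeasure η] [IsProbabilityMeasure γ]
    (hη1 : Integrable id η) (hγ1 : Integrable id γ)
    (hmean : ∫ x, x ∂η = ∫ x, x ∂γ)
    (hsupη : η (Icc a b)ᶜ = 0) (hsupγ : γ (Ioo a b) = 0)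
    (hC : ∀ x : ℝ, Cfun η x ≤ Cfun γ x)
    (P Q : ℝ → ℝ) (hPQ : AttainsSup η γ a b P Q)
    (hPmeas : Measurable P) (hQmeas : Measurable Q)
    (hPmono : AntitoneOn P (Ioo 0 1)) (hQmono : AntitoneOn Q (Ioo 0 1))
    {Ω : Type*} [MeasurableSpace Ω] (Pr : Measure Ω) [IsProbabilityMeasure Pr]
    (U V : Ω → ℝ) (hU : Measurable U) (hV : Measurable V)
    (hUlaw : Pr.map U = volume.restrict (Ioo (0 : ℝ) 1))
    (hVlaw : Pr.map V = volume.restrict (Ioo (0 : ℝ) 1))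
    (hUV : IndepFun U V Pr) :
    Pr.map (fun ω => Finv η (U ω)) = η ∧
    Pr.map (fun ω =>
      if V ω ≤ (Q (U ω) - Finv η (U ω)) / (Q (U ω) - P (U ω))
      then P (U ω) else Q (U ω)) = γ := by
  refine ⟨map_Finv_uniform hU hUlaw, ?_⟩
  set w : ℝ → ℝ := fun u => (Q u - (Ioo (0 : ℝ) 1).indicator (Finv η) u) / (Q u - P u) with hw_def
  have hwm : Measurable w := (hQmeas.sub measurable_indicator_Finv).div (hQmeas.sub hPmeas)
  have hw : ∀ u ∈ Ioo (0 : ℝ) 1, w u = (Q u - Finv η u) / (Q u - P u) := fun u hu => by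
    rw [hw_def]
    simp only [indicator_of_mem hu]
  have hmem : ∀ᵐ u ∂(Pr.map U), u ∈ Ioo (0 : ℝ) 1 := by
    rw [hUlaw]
    exact ae_restrict_mem measurableSet_Ioo
  have hae : (fun ω => if V ω ≤ (Q (U ω) - Finv η (U ω)) / (Q (U ω) - P (U ω))
      then P (U ω) else Q (U ω)) =ᵐ[Pr]
      fun ω => if V ω ≤ w (U ω) then P (U ω) else Q (U ω) := by
    filter_upwards [ae_of_ae_map hU.aemeasurable hmem] with ω hω
    rw [hw _ hω]
  have hYm : Measurable fun ω => if V ω ≤ w (U ω) then P (U ω) else Q (U ω) :=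
    Measurable.ite (measurableSet_le hV (hwm.comp hU)) (hPmeas.comp hU) (hQmeas.comp hU)
  rw [Measure.map_congr hae]
  have := Measure.isProbabilityMeasure_map (μ := Pr) hYm.aemeasurable
  refine Measure.ext_of_Iic _ _ fun x => ?_
  rw [map_ite_uniform_Iic hU hV hUlaw hVlaw hUV hPmeas hQmeas hwm
      (fun u hu => by rw [hw u hu]; exact Ioo_subset_Icc_self (hPQ.weight_mem_Ioo hu)) x,
    hPQ.integral_eq_cdf hη1 hγ1 hsupη hsupγ hC hPmeas hQmeas hwm hw x, ofReal_measureReal]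
end
end

section
/- Let μ and ν be probability measures on ℝ with equal finite means and C_μ ≤ C_ν, with κ := (μ ∧ ν)(ℝ) ∈ (0,1). Suppose η := (μ − ν)⁺ is supported in [a,b] (a < b) and γ := (ν − μ)⁺ satisfies γ((a,b)) = 0. Set η̄ = η/(1−κ) and γ̄ = γ/(1−κ), and let F_{η̄}⁻¹, φ, P, Q be the objects of the disjoint-support construction applied to (η̄, γ̄), with P, Q measurable, nonincreasing, and attaining the supremum defining φ(u) for every u ∈ (0,1). Let U, V be independent uniform random variables on (0,1) and let Z be an independent Bernoulli random variable with P(Z = 1) = κ. Conditional on Z = 1, set X = Y with X distributed according to (μ ∧ ν)/κ; conditional on Z = 0, set X = F_{η̄}⁻¹(U) and Y = P(U) if V ≤ (Q(U) − F_{η̄}⁻¹(U))/(Q(U) − P(U)), Y = Q(U) otherwise. Then X has law μ and Y has law ν. -/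
open Set MeasureTheory ProbabilityTheory
open scoped ENNReal Classical

noncomputable section

/-- Positive part of the signed measure μ − ν (Jordan decomposition). -/
def posPartMeasure (μ ν : Measure ℝ) [IsFiniteMeasure μ] [IsFiniteMeasure ν] : Measure ℝ :=
  (μ.toSignedMeasure - ν.toSignedMeasure).toJordanDecomposition.posPart

set_option linter.unusedSectionVars false

lemma inf_add_posPartMeasure (μ ν : Measure ℝ) [IsFiniteMeasure μ] [IsFiniteMeasure ν] :
    μ ⊓ ν + posPartMeasure μ ν = μ := by
  obtain ⟨i, hi, hpos, hneg, hJ, -⟩ :=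
    (μ.toSignedMeasure - ν.toSignedMeasure).toJordanDecomposition_spec
  have hle : ∀ A, MeasurableSet A → A ⊆ i → ν A ≤ μ A := fun A hA hAi => by
    have h := VectorMeasure.nonneg_of_zero_le_restrict _
      (VectorMeasure.zero_le_restrict_subset _ hi hAi hpos)
    rw [Measure.toSignedMeasure_sub_apply hA] at h
    exact (ENNReal.toReal_le_toReal (measure_ne_top _ _) (measure_ne_top _ _)).1 (sub_nonneg.1 h)
  have hge : ∀ A, MeasurableSet A → A ⊆ iᶜ → μ A ≤ ν A := fun A hA hAi => by
    have h := VectorMeasure.nonpos_of_restrict_le_zero _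
      (VectorMeasure.restrict_le_zero_subset _ hi.compl hAi hneg)
    rw [Measure.toSignedMeasure_sub_apply hA] at h
    exact (ENNReal.toReal_le_toReal (measure_ne_top _ _) (measure_ne_top _ _)).1 (sub_nonpos.1 h)
  have hinf : μ ⊓ ν = ν.restrict i + μ.restrict iᶜ := by
    refine le_antisymm (Measure.le_iff.2 fun A hA => ?_) (le_inf ?_ ?_)
    · rw [Measure.add_apply, Measure.restrict_apply hA, Measure.restrict_apply hA,
        ← measure_inter_add_sdiff A hi]
      exact add_le_add (Measure.le_iff'.1 inf_le_right _) (Measure.le_iff'.1 inf_le_left _)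
    · refine Measure.le_iff.2 fun A hA => ?_
      rw [Measure.add_apply, Measure.restrict_apply hA, Measure.restrict_apply hA,
        ← measure_inter_add_sdiff A hi]
      exact add_le_add (hle _ (hA.inter hi) inter_subset_right) le_rfl
    · refine Measure.le_iff.2 fun A hA => ?_
      rw [Measure.add_apply, Measure.restrict_apply hA, Measure.restrict_apply hA,
        ← measure_inter_add_sdiff A hi]
      exact add_le_add le_rfl (hge _ (hA.inter hi.compl) inter_subset_right)
  ext A hA
  have hp : posPartMeasure μ ν A = μ (i ∩ A) - ν (i ∩ A) := by
    have h : (posPartMeasure μ ν).real A = μ.real (i ∩ A) - ν.real (i ∩ A) := by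
      rw [posPartMeasure, hJ, SignedMeasure.toMeasureOfZeroLE_real_apply _ hpos hi hA,
        Measure.toSignedMeasure_sub_apply (hi.inter hA)]
    have hfin : IsFiniteMeasure (posPartMeasure μ ν) := by
      unfold posPartMeasure; infer_instance
    rw [← ENNReal.toReal_eq_toReal_iff' (measure_ne_top _ _)
      (ENNReal.sub_ne_top (measure_ne_top _ _)), ENNReal.toReal_sub_of_le
      (hle _ (hi.inter hA) inter_subset_left) (measure_ne_top _ _)]
    exact h
  rw [Measure.add_apply, hinf, Measure.add_apply, hp, Measure.restrict_apply hA,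
    Measure.restrict_apply hA, inter_comm A i, add_right_comm,
    add_tsub_cancel_of_le (hle _ (hi.inter hA) inter_subset_left), inter_comm i A]
  exact measure_inter_add_sdiff A hi

/-- The put function `x ↦ ∫ (x − y)⁺ ζ(dy)`. -/
def putFun (ζ : Measure ℝ) (x : ℝ) : ℝ := ∫ y, max (x - y) 0 ∂ζ

section PutCall

variable {ζ : Measure ℝ}

lemma integrable_put [IsFiniteMeasure ζ] (h : Integrable id ζ) (x : ℝ) :
    Integrable (fun y => max (x - y) 0) ζ :=
  ((integrable_const x).sub h).sup (integrable_const 0)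

lemma integrable_call [IsFiniteMeasure ζ] (h : Integrable id ζ) (x : ℝ) :
    Integrable (fun y => max (y - x) 0) ζ :=
  (h.sub (integrable_const x)).sup (integrable_const 0)

lemma Cfun_eq [IsProbabilityMeasure ζ] (h : Integrable id ζ) (x : ℝ) :
    Cfun ζ x = putFun ζ x + ((∫ y, y ∂ζ) - x) := by
  have h' : Integrable (fun y : ℝ => y) ζ := h
  have h1 : (∫ y, y ∂ζ) - x = ∫ y, (y - x) ∂ζ := by
    rw [integral_sub h' (integrable_const x)]; simp
  have h2 : Integrable (fun y => y - x) ζ := h'.sub (integrable_const x)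
  rw [h1, Cfun, putFun, ← integral_add (integrable_put h x) h2]
  refine integral_congr_ae (ae_of_all _ fun y => ?_)
  dsimp only
  rcases le_total x y with hxy | hxy
  · rw [max_eq_left (by linarith), max_eq_right (by linarith)]; ring
  · rw [max_eq_right (by linarith), max_eq_left (by linarith)]; ring

lemma putFun_sub_eq [IsFiniteMeasure ζ] (h : Integrable id ζ) (x y : ℝ) :
    putFun ζ y - putFun ζ x = ∫ t, (max (y - t) 0 - max (x - t) 0) ∂ζ :=
  (integral_sub (integrable_put h y) (integrable_put h x)).symm

lemma le_putFun_sub [IsFiniteMeasure ζ] (h : Integrable id ζ) {x y : ℝ} (hxy : x ≤ y) :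
    ζ.real (Iic x) * (y - x) ≤ putFun ζ y - putFun ζ x := by
  rw [putFun_sub_eq h, ← smul_eq_mul, ← integral_indicator_const _ measurableSet_Iic]
  refine integral_mono ((integrable_const _).indicator measurableSet_Iic)
    ((integrable_put h y).sub (integrable_put h x)) fun t => ?_
  by_cases ht : t ∈ Iic x
  · have : t ≤ x := ht
    simp only [indicator_of_mem ht]
    rw [max_eq_left (by linarith), max_eq_left (by linarith)]; linarith
  · simp only [indicator_of_notMem ht]
    exact sub_nonneg.2 (max_le_max (by linarith) le_rfl)

lemma putFun_sub_le [IsFiniteMeasure ζ] (h : Integrable id ζ) {x y : ℝ} (hxy : x ≤ y) :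
    putFun ζ y - putFun ζ x ≤ ζ.real (Iio y) * (y - x) := by
  rw [putFun_sub_eq h, ← smul_eq_mul, ← integral_indicator_const _ measurableSet_Iio]
  refine integral_mono ((integrable_put h y).sub (integrable_put h x))
    ((integrable_const _).indicator measurableSet_Iio) fun t => ?_
  by_cases ht : t ∈ Iio y
  · have : t < y := ht
    simp only [indicator_of_mem ht]
    rw [max_eq_left (by linarith)]
    linarith [le_max_left (x - t) 0]
  · have : y ≤ t := not_lt.1 ht
    simp only [indicator_of_notMem ht]
    rw [max_eq_right (by linarith), max_eq_right (by linarith)]; simp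

lemma putFun_sub_le_Iic [IsFiniteMeasure ζ] (h : Integrable id ζ) {x y : ℝ} (hxy : x ≤ y) :
    putFun ζ y - putFun ζ x ≤ ζ.real (Iic y) * (y - x) :=
  (putFun_sub_le h hxy).trans
    (mul_le_mul_of_nonneg_right (measureReal_mono Iio_subset_Iic_self) (sub_nonneg.2 hxy))

lemma continuous_putFun [IsFiniteMeasure ζ] (h : Integrable id ζ) : Continuous (putFun ζ) := by
  have hK : ∀ x y, x ≤ y → dist (putFun ζ x) (putFun ζ y) ≤ ζ.real univ * dist x y := by
    intro x y hxy
    have h1 := le_putFun_sub h hxy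
    have h2 := putFun_sub_le h hxy
    have h3 : ζ.real (Iio y) ≤ ζ.real univ := measureReal_mono (subset_univ _)
    have h4 : 0 ≤ ζ.real (Iic x) := measureReal_nonneg
    rw [dist_comm, Real.dist_eq, dist_comm, Real.dist_eq, abs_of_nonneg (sub_nonneg.2 hxy),
      abs_of_nonneg (by nlinarith)]
    nlinarith
  refine (LipschitzWith.of_dist_le_mul (K := ⟨ζ.real univ, measureReal_nonneg⟩)
    fun x y => ?_).continuous
  rcases le_total x y with hxy | hxy
  · exact hK x y hxy
  · rw [dist_comm, dist_comm x]; exact hK y x hxy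

end PutCall

section Quantile

variable {η : Measure ℝ} [IsProbabilityMeasure η] {u : ℝ}

lemma le_real_Iic_Finv (hu : u ∈ Ioo (0 : ℝ) 1) : u ≤ η.real (Iic (Finv η u)) :=
  (Finv_le_iff hu _).1 le_rfl

lemma real_Iio_Finv_le (hu : u ∈ Ioo (0 : ℝ) 1) : η.real (Iio (Finv η u)) ≤ u := by
  have h : ∀ y < Finv η u, η.real (Iic y) ≤ u := fun y hy => by
    by_contra! h
    exact absurd ((Finv_le_iff hu y).2 h.le) (not_le.2 hy)
  obtain ⟨s, hs, hs1, hs2⟩ := exists_seq_strictMono_tendsto (Finv η u)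
  have hU : Iio (Finv η u) = ⋃ n, Iic (s n) := by
    ext y
    simp only [mem_Iio, mem_iUnion, mem_Iic]
    constructor
    · intro hy
      obtain ⟨n, hn⟩ := (hs2.eventually (lt_mem_nhds hy)).exists
      exact ⟨n, hn.le⟩
    · rintro ⟨n, hn⟩
      exact hn.trans_lt (hs1 n)
  have ht : Filter.Tendsto (fun n => η (Iic (s n))) Filter.atTop
      (nhds (η (⋃ n, Iic (s n)))) :=
    tendsto_measure_iUnion_atTop fun m n hmn => Iic_subset_Iic.2 (hs.monotone hmn)
  rw [← hU] at ht
  exact le_of_tendsto ((ENNReal.tendsto_toReal (measure_ne_top _ _)).comp ht)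
    (Filter.Eventually.of_forall fun n => h _ (hs1 n))

lemma monotoneOn_Finv : MonotoneOn (Finv η) (Ioo 0 1) := fun _ hu _ hv huv =>
  (Finv_le_iff hu _).2 (huv.trans (le_real_Iic_Finv hv))

lemma aemeasurable_Finv : AEMeasurable (Finv η) (volume.restrict (Ioo (0 : ℝ) 1)) :=
  aemeasurable_restrict_of_monotoneOn measurableSet_Ioo monotoneOn_Finv

lemma map_Finv : (volume.restrict (Ioo (0 : ℝ) 1)).map (Finv η) = η := by
  refine (Measure.ext_of_Iic _ _ fun x => ?_).symm
  rw [Measure.map_apply_of_aemeasurable aemeasurable_Finv measurableSet_Iic]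
  have h1 : η.real (Iic x) ≤ 1 := measureReal_le_one
  have hset : (Finv η ⁻¹' Iic x) ∩ Ioo (0 : ℝ) 1 = Iic (η.real (Iic x)) ∩ Ioo 0 1 := by
    ext u
    simp only [mem_inter_iff, mem_preimage, mem_Iic]
    exact and_congr_left fun hu => Finv_le_iff hu x
  have hm : NullMeasurableSet (Finv η ⁻¹' Iic x) (volume.restrict (Ioo (0 : ℝ) 1)) :=
    aemeasurable_Finv.nullMeasurableSet_preimage measurableSet_Iic
  rw [Measure.restrict_apply₀ hm, hset]
  have hae : (Iic (η.real (Iic x)) ∩ Ioo 0 1 : Set ℝ) =ᵐ[volume] Ioc 0 (η.real (Iic x)) := by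
    have : (Iic (η.real (Iic x)) ∩ Ioc 0 1 : Set ℝ) = Ioc 0 (η.real (Iic x)) := by
      ext u; simp only [mem_inter_iff, mem_Iic, mem_Ioc]
      exact ⟨fun h => ⟨h.2.1, h.1⟩, fun h => ⟨h.2, h.1, h.2.trans h1⟩⟩
    rw [← this]
    exact (Filter.EventuallyEq.refl _ _).inter Ioo_ae_eq_Ioc
  rw [measure_congr hae, Real.volume_Ioc, sub_zero]
  exact (ENNReal.ofReal_toReal (measure_ne_top _ _)).symm

end Quantile

/-- A pair of probability measures with equal finite means, in convex order, with the first
supported in `[a, b]` and the second giving no mass to `(a, b)`. -/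
structure DisjointPair (η γ : Measure ℝ) (a b : ℝ) : Prop where
  lt : a < b
  integrable_left : Integrable id η
  integrable_right : Integrable id γ
  mean_eq : ∫ y, y ∂η = ∫ y, y ∂γ
  Cfun_le : ∀ x, Cfun η x ≤ Cfun γ x
  left_compl : η (Icc a b)ᶜ = 0
  right_Ioo : γ (Ioo a b) = 0

namespace DisjointPair

variable {η γ : Measure ℝ} [IsProbabilityMeasure η] [IsProbabilityMeasure γ] {a b u x y : ℝ}
  {P Q : ℝ → ℝ}

lemma Dfun_nonneg (h : DisjointPair η γ a b) (x : ℝ) : 0 ≤ Dfun η γ x :=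
  sub_nonneg.2 (h.Cfun_le x)

lemma Dfun_eq (h : DisjointPair η γ a b) (x : ℝ) :
    Dfun η γ x = putFun γ x - putFun η x := by
  rw [Dfun, Cfun_eq h.integrable_left, Cfun_eq h.integrable_right, h.mean_eq]; ring

lemma continuous_Dfun (h : DisjointPair η γ a b) : Continuous (Dfun η γ) := by
  have : Dfun η γ = fun x => putFun γ x - putFun η x := funext h.Dfun_eq
  rw [this]
  exact (continuous_putFun h.integrable_right).sub (continuous_putFun h.integrable_left)

lemma left_Iio (h : DisjointPair η γ a b) : η.real (Iio a) = 0 := by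
  rw [Measure.real, measure_mono_null _ h.left_compl, ENNReal.toReal_zero]
  exact fun x hx hx' => absurd hx'.1 (not_le.2 hx)

lemma left_Iic (h : DisjointPair η γ a b) (hx : b ≤ x) : η.real (Iic x) = 1 := by
  have h0 : η.real (Iic x)ᶜ = 0 := by
    rw [Measure.real, measure_mono_null _ h.left_compl, ENNReal.toReal_zero]
    exact fun y hy hy' => hy (hy'.2.trans hx)
  rw [probReal_compl_eq_one_sub measurableSet_Iic] at h0
  linarith

lemma right_Iic (h : DisjointPair η γ a b) (hx : a ≤ x) (hxb : x < b) :
    γ.real (Iic x) = γ.real (Iic a) := by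
  refine le_antisymm ?_ (measureReal_mono (Iic_subset_Iic.2 hx))
  have h0 : γ.real (Ioc a x) = 0 := by
    rw [Measure.real, measure_mono_null _ h.right_Ioo, ENNReal.toReal_zero]
    exact fun y hy => ⟨hy.1, hy.2.trans_lt hxb⟩
  rw [← Iic_union_Ioc_eq_Iic hx]
  linarith [measureReal_union_le (μ := γ) (Iic a) (Ioc a x)]

lemma right_Iio (h : DisjointPair η γ a b) (hx : x ≤ b) : γ.real (Iio x) ≤ γ.real (Iic a) := by
  have h0 : γ.real (Ioo a b) = 0 := by rw [Measure.real, h.right_Ioo, ENNReal.toReal_zero]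
  have h1 : Iio x ⊆ Iic a ∪ Ioo a b := fun y hy => by
    rcases le_or_gt y a with hya | hya
    · exact Or.inl hya
    · exact Or.inr ⟨hya, lt_of_lt_of_le hy hx⟩
  linarith [measureReal_union_le (μ := γ) (Iic a) (Ioo a b), measureReal_mono (μ := γ) h1]

lemma putFun_left (h : DisjointPair η γ a b) (hxy : x ≤ y) (hy : y ≤ a) :
    putFun η y = putFun η x := by
  have h1 := le_putFun_sub h.integrable_left hxy
  have h2 := putFun_sub_le h.integrable_left hxy
  have h3 : η.real (Iio y) ≤ 0 := h.left_Iio ▸ measureReal_mono (Iio_subset_Iio hy)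
  have h4 : 0 ≤ η.real (Iic x) := measureReal_nonneg
  nlinarith

lemma putFun_right (h : DisjointPair η γ a b) (hx : a ≤ x) (hxy : x ≤ y) (hy : y ≤ b) :
    putFun γ y - putFun γ x = γ.real (Iic a) * (y - x) := by
  refine le_antisymm ((putFun_sub_le h.integrable_right hxy).trans ?_)
    (le_trans ?_ (le_putFun_sub h.integrable_right hxy))
  · exact mul_le_mul_of_nonneg_right (h.right_Iio hy) (sub_nonneg.2 hxy)
  · exact mul_le_mul_of_nonneg_right (measureReal_mono (Iic_subset_Iic.2 hx)) (sub_nonneg.2 hxy)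

lemma le_Dfun_sub_left (h : DisjointPair η γ a b) (hxy : x ≤ y) (hy : y ≤ a) :
    γ.real (Iic x) * (y - x) ≤ Dfun η γ y - Dfun η γ x := by
  rw [h.Dfun_eq, h.Dfun_eq, h.putFun_left hxy hy]
  linarith [le_putFun_sub h.integrable_right hxy]

lemma Dfun_sub_left_le (h : DisjointPair η γ a b) (hxy : x ≤ y) (hy : y ≤ a) :
    Dfun η γ y - Dfun η γ x ≤ γ.real (Iic y) * (y - x) := by
  rw [h.Dfun_eq, h.Dfun_eq, h.putFun_left hxy hy]
  linarith [putFun_sub_le_Iic h.integrable_right hxy]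

lemma putFun_left_of_ge (h : DisjointPair η γ a b) (hx : b ≤ x) (hxy : x ≤ y) :
    putFun η y - putFun η x = y - x := by
  have h1 := le_putFun_sub h.integrable_left hxy
  have h2 := putFun_sub_le_Iic h.integrable_left hxy
  rw [h.left_Iic hx] at h1
  rw [h.left_Iic (hx.trans hxy)] at h2
  linarith

lemma le_Dfun_sub_right (h : DisjointPair η γ a b) (hx : b ≤ x) (hxy : x ≤ y) :
    (γ.real (Iic x) - 1) * (y - x) ≤ Dfun η γ y - Dfun η γ x := by
  rw [h.Dfun_eq, h.Dfun_eq]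
  linarith [le_putFun_sub h.integrable_right hxy, h.putFun_left_of_ge hx hxy]

lemma Dfun_sub_right_le (h : DisjointPair η γ a b) (hx : b ≤ x) (hxy : x ≤ y) :
    Dfun η γ y - Dfun η γ x ≤ (γ.real (Iic y) - 1) * (y - x) := by
  rw [h.Dfun_eq, h.Dfun_eq]
  linarith [putFun_sub_le_Iic h.integrable_right hxy, h.putFun_left_of_ge hx hxy]

lemma Finv_mem (h : DisjointPair η γ a b) (hu : u ∈ Ioo (0 : ℝ) 1) : Finv η u ∈ Icc a b := by
  constructor
  · by_contra! hlt
    have h1 := (Finv_le_iff (η := η) hu _).1 le_rfl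
    have h2 : η.real (Iic (Finv η u)) ≤ 0 :=
      h.left_Iio ▸ measureReal_mono (Iic_subset_Iio.2 hlt)
    linarith [hu.1]
  · rw [Finv_le_iff hu, h.left_Iic le_rfl]; exact hu.2.le

/-- On `[a, b]` the line of slope `γ_a - u` through the graph of `D` at `F_η⁻¹(u)` lies above
the graph of `D`. -/
lemma Dfun_le_tangent (h : DisjointPair η γ a b) (hu : u ∈ Ioo (0 : ℝ) 1) (hx : x ∈ Icc a b) :
    Dfun η γ x - Dfun η γ (Finv η u) ≤ (γ.real (Iic a) - u) * (x - Finv η u) := by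
  have hG := h.Finv_mem hu
  rw [h.Dfun_eq, h.Dfun_eq]
  rcases le_total x (Finv η u) with hle | hle
  · have h1 := h.putFun_right hx.1 hle hG.2
    have h2 := putFun_sub_le h.integrable_left hle
    have h3 := real_Iio_Finv_le (η := η) hu
    nlinarith
  · have h1 := h.putFun_right hG.1 hle hx.2
    have h2 := le_putFun_sub h.integrable_left hle
    have h3 := le_real_Iic_Finv (η := η) hu
    nlinarith

lemma Dfun_Finv_le_left (h : DisjointPair η γ a b) (hu : u ∈ Ioo (0 : ℝ) 1) (hx : x ≤ a) :
    Dfun η γ (Finv η u) ≤ Dfun η γ x + γ.real (Iic a) * (Finv η u - x) := by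
  have hG := h.Finv_mem hu
  have hle := hx.trans hG.1
  have h1 := putFun_sub_le h.integrable_right hle
  have h2 := le_putFun_sub h.integrable_left hle
  have h3 := h.right_Iio hG.2
  have h4 : 0 ≤ η.real (Iic x) := measureReal_nonneg
  rw [h.Dfun_eq, h.Dfun_eq]
  nlinarith

lemma Dfun_Finv_le_right (h : DisjointPair η γ a b) (hu : u ∈ Ioo (0 : ℝ) 1) (hx : b ≤ x) :
    Dfun η γ (Finv η u) ≤ Dfun η γ x + (1 - γ.real (Iic a)) * (x - Finv η u) := by
  have hG := h.Finv_mem hu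
  have hle := hG.2.trans hx
  have h1 := le_putFun_sub h.integrable_right hle
  have h2 := putFun_sub_le h.integrable_left hle
  have h3 : γ.real (Iic a) ≤ γ.real (Iic (Finv η u)) := measureReal_mono (Iic_subset_Iic.2 hG.1)
  have h4 : η.real (Iio x) ≤ 1 := measureReal_le_one
  rw [h.Dfun_eq, h.Dfun_eq]
  nlinarith

lemma Efun_eq (u x : ℝ) : Efun η γ a u x =
    Dfun η γ (Finv η u) + (x - Finv η u) * (γ.real (Iic a) - u) - Dfun η γ x := rfl

lemma Efun_sub_le_right (h : DisjointPair η γ a b) (hu : u ∈ Ioo (0 : ℝ) 1) {p q : ℝ}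
    (hp : p ≤ a) (hq : b ≤ q) :
    Efun η γ a u q - Dfun η γ p ≤ γ.real (Iic a) * (q - p) := by
  have hG := h.Finv_mem hu
  have h1 := h.Dfun_Finv_le_left hu hp
  have h2 := h.Dfun_nonneg q
  rw [Efun_eq]
  nlinarith [hu.1, hG.2]

lemma Efun_sub_le_one_sub (h : DisjointPair η γ a b) (hu : u ∈ Ioo (0 : ℝ) 1) {p q : ℝ}
    (hp : p ≤ a) (hq : b ≤ q) :
    Efun η γ a u q - Dfun η γ p ≤ (1 - u) * (q - p) := by
  have hG := h.Finv_mem hu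
  have h1 := h.Dfun_Finv_le_right hu hq
  have h2 := h.Dfun_nonneg p
  have h3 : 0 ≤ (1 - u) * (Finv η u - p) :=
    mul_nonneg (by linarith [hu.2]) (by linarith [hG.1])
  rw [Efun_eq]
  nlinarith

lemma phiFn_le (h : DisjointPair η γ a b) (hu : u ∈ Ioo (0 : ℝ) 1)
    (hPQ : AttainsSup η γ a b P Q) :
    phiFn η γ a b u ≤ γ.real (Iic a) ∧ phiFn η γ a b u ≤ 1 - u := by
  obtain ⟨hP, hQ, hPG, hGQ, heq⟩ := hPQ u hu
  rw [heq]
  constructor <;> rw [div_le_iff₀ (by linarith)]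
  · exact h.Efun_sub_le_right hu hP hQ
  · exact h.Efun_sub_le_one_sub hu hP hQ

/-- The supremum defining `φ` also dominates the closed family `p ≤ a`, `b ≤ q`. -/
lemma Efun_sub_le_phiFn (h : DisjointPair η γ a b) (hu : u ∈ Ioo (0 : ℝ) 1) {p q : ℝ}
    (hp : p ≤ a) (hq : b ≤ q) :
    Efun η γ a u q - Dfun η γ p ≤ phiFn η γ a b u * (q - p) := by
  have hG := h.Finv_mem hu
  have hstrict : ∀ p < a, ∀ q > b,
      Efun η γ a u q - Dfun η γ p ≤ phiFn η γ a b u * (q - p) := fun p hp q hq => by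
    have hpG := hp.trans_le hG.1
    have hGq := hG.2.trans_lt hq
    rw [← div_le_iff₀ (by linarith)]
    refine le_csSup ⟨γ.real (Iic a), ?_⟩ ⟨p, q, hp.le, hq.le, hpG, hGq, rfl⟩
    rintro r ⟨p', q', hp', hq', hpG', hGq', rfl⟩
    rw [div_le_iff₀ (by linarith)]
    exact h.Efun_sub_le_right hu hp' hq'
  have hD := h.continuous_Dfun
  have hE : Continuous (Efun η γ a u) := by
    unfold Efun; fun_prop
  have hp1 : ∀ q > b, ∀ p ∈ Iic a,
      Efun η γ a u q - Dfun η γ p ≤ phiFn η γ a b u * (q - p) := fun q hq => by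
    have hcl : IsClosed {p | Efun η γ a u q - Dfun η γ p ≤ phiFn η γ a b u * (q - p)} :=
      isClosed_le (by fun_prop) (by fun_prop)
    have := hcl.closure_subset_iff.2 (fun p (hp : p ∈ Iio a) => hstrict p hp q hq)
    rw [closure_Iio] at this
    exact fun p hp => this hp
  have hcl : IsClosed {q | Efun η γ a u q - Dfun η γ p ≤ phiFn η γ a b u * (q - p)} :=
    isClosed_le (by fun_prop) (by fun_prop)
  have := hcl.closure_subset_iff.2 (fun q (hq : q ∈ Ioi b) => hp1 q hq p hp)
  rw [closure_Ioi] at this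
  exact this hq

lemma phiFn_nonneg (h : DisjointPair η γ a b) (hu : u ∈ Ioo (0 : ℝ) 1) :
    0 ≤ phiFn η γ a b u := by
  by_contra! hneg
  set φ := phiFn η γ a b u
  set c := Efun η γ a u b - Dfun η γ a
  have key : ∀ p ≤ a, c ≤ φ * (b - p) := fun p hp => by
    have h1 := h.Efun_sub_le_phiFn hu hp le_rfl
    have h2 := h.le_Dfun_sub_left hp le_rfl
    have h3 : 0 ≤ γ.real (Iic p) * (a - p) := mul_nonneg measureReal_nonneg (sub_nonneg.2 hp)
    linarith
  have h1 := key (min a (b - (c - 1) / φ)) (min_le_left _ _)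
  have h2 : (c - 1) / φ ≤ b - min a (b - (c - 1) / φ) := by
    linarith [min_le_right a (b - (c - 1) / φ)]
  have h3 := mul_le_mul_of_nonpos_left h2 hneg.le
  rw [mul_div_cancel₀ _ hneg.ne] at h3
  linarith

lemma sub_le_phiFn (h : DisjointPair η γ a b) (hu : u ∈ Ioo (0 : ℝ) 1) :
    γ.real (Iic a) - u ≤ phiFn η γ a b u := by
  by_contra! hlt
  set φ := phiFn η γ a b u
  set g := γ.real (Iic a)
  set c := Dfun η γ (Finv η u) - Finv η u * (g - u) - Dfun η γ b - Dfun η γ a + φ * a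
  have hpos : 0 < g - u - φ := by linarith
  have key : ∀ q ≥ b, (g - u - φ) * q ≤ - c := fun q hq => by
    have h1 := h.Efun_sub_le_phiFn hu le_rfl hq
    rw [Efun_eq] at h1
    have h2 := h.Dfun_sub_right_le le_rfl hq
    have h3 : 0 ≤ (1 - γ.real (Iic q)) * (q - b) :=
      mul_nonneg (sub_nonneg.2 measureReal_le_one) (sub_nonneg.2 hq)
    simp only [c]
    linarith
  have h1 := key (max b ((-c + 1) / (g - u - φ))) (le_max_left _ _)
  have h2 := mul_le_mul_of_nonneg_left (le_max_right b ((-c + 1) / (g - u - φ))) hpos.le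
  rw [mul_div_cancel₀ _ hpos.ne'] at h2
  linarith

/-- The conditional probability of the down-move. -/
def weight (η : Measure ℝ) (P Q : ℝ → ℝ) (u : ℝ) : ℝ := (Q u - Finv η u) / (Q u - P u)

lemma weight_mem (hPQ : AttainsSup η γ a b P Q) (hu : u ∈ Ioo (0 : ℝ) 1) :
    weight η P Q u ∈ Ioo (0 : ℝ) 1 := by
  obtain ⟨hP, hQ, hPG, hGQ, -⟩ := hPQ u hu
  refine ⟨div_pos (by linarith) (by linarith), ?_⟩
  rw [weight, div_lt_one (by linarith)]; linarith

lemma attained (hPQ : AttainsSup η γ a b P Q) (hu : u ∈ Ioo (0 : ℝ) 1) :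
    Efun η γ a u (Q u) - Dfun η γ (P u) = phiFn η γ a b u * (Q u - P u) := by
  obtain ⟨hP, hQ, hPG, hGQ, heq⟩ := hPQ u hu
  rw [heq, div_mul_cancel₀]
  linarith

/-- `-weight` is a subgradient of `φ`. -/
lemma subgradient (h : DisjointPair η γ a b) (hPQ : AttainsSup η γ a b P Q) {v : ℝ}
    (hu : u ∈ Ioo (0 : ℝ) 1) (hv : v ∈ Ioo (0 : ℝ) 1) :
    phiFn η γ a b u - weight η P Q u * (v - u) ≤ phiFn η γ a b v := by
  obtain ⟨hP, hQ, hPG, hGQ, -⟩ := hPQ u hu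
  have hpos : 0 < Q u - P u := by linarith
  have h1 := attained hPQ hu
  have h2 := h.Efun_sub_le_phiFn hv hP hQ
  have h3 := h.Dfun_le_tangent hv (h.Finv_mem hu)
  have h4 : weight η P Q u * (Q u - P u) = Q u - Finv η u := div_mul_cancel₀ _ hpos.ne'
  rw [Efun_eq] at h1 h2
  refine le_of_mul_le_mul_right ?_ hpos
  linear_combination h2 - h1 + h3 - (v - u) * h4

lemma antitoneOn_weight (h : DisjointPair η γ a b) (hPQ : AttainsSup η γ a b P Q) :
    AntitoneOn (weight η P Q) (Ioo 0 1) := fun u hu v hv huv => by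
  have h1 := h.subgradient hPQ hu hv
  have h2 := h.subgradient hPQ hv hu
  rcases huv.eq_or_lt with rfl | hlt
  · exact le_rfl
  · nlinarith

lemma phiFn_le_of_P_le (h : DisjointPair η γ a b) (hPQ : AttainsSup η γ a b P Q)
    (hu : u ∈ Ioo (0 : ℝ) 1) (hx : x < a) (hPx : P u ≤ x) :
    phiFn η γ a b u ≤ γ.real (Iic x) := by
  obtain ⟨hP, hQ, -, -, -⟩ := hPQ u hu
  have key : ∀ y ∈ Ioo x a, phiFn η γ a b u ≤ γ.real (Iic y) := fun y hy => by
    have h1 := h.Efun_sub_le_phiFn hu hy.2.le hQ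
    have h2 := attained hPQ hu
    have h3 := h.Dfun_sub_left_le (hPx.trans hy.1.le) hy.2.le
    have hpos : 0 < y - P u := by linarith [hy.1]
    refine le_of_mul_le_mul_right ?_ hpos
    linarith
  have hc := ((cdf γ).right_continuous x).tendsto.mono_left
    (nhdsWithin_mono x Ioi_subset_Ici_self)
  rw [← cdf_eq_real]
  refine ge_of_tendsto hc ?_
  filter_upwards [Ioo_mem_nhdsGT hx] with y hy
  rw [cdf_eq_real]; exact key y hy

lemma le_phiFn_of_lt_P (h : DisjointPair η γ a b) (hPQ : AttainsSup η γ a b P Q)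
    (hu : u ∈ Ioo (0 : ℝ) 1) (hPx : x < P u) :
    γ.real (Iic x) ≤ phiFn η γ a b u := by
  obtain ⟨hP, hQ, -, -, -⟩ := hPQ u hu
  have h1 := h.Efun_sub_le_phiFn hu (hPx.le.trans hP) hQ
  have h2 := attained hPQ hu
  have h3 := h.le_Dfun_sub_left hPx.le hP
  refine le_of_mul_le_mul_right ?_ (sub_pos.2 hPx)
  linarith

lemma le_of_Q_le (h : DisjointPair η γ a b) (hPQ : AttainsSup η γ a b P Q)
    (hu : u ∈ Ioo (0 : ℝ) 1) (hQx : Q u ≤ x) :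
    1 - u - phiFn η γ a b u ≤ γ.real (Iic x) - γ.real (Iic a) := by
  obtain ⟨hP, hQ, -, -, -⟩ := hPQ u hu
  have key : ∀ y > x, 1 - u - phiFn η γ a b u + γ.real (Iic a) ≤ γ.real (Iic y) :=
    fun y hy => by
    have h1 := h.Efun_sub_le_phiFn hu hP (hQ.trans (hQx.trans hy.le))
    have h2 := attained hPQ hu
    have h3 := h.Dfun_sub_right_le hQ (hQx.trans hy.le)
    have hpos : 0 < y - Q u := by linarith
    rw [Efun_eq] at h1 h2
    refine le_of_mul_le_mul_right ?_ hpos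
    linarith
  have hc := ((cdf γ).right_continuous x).tendsto.mono_left
    (nhdsWithin_mono x Ioi_subset_Ici_self)
  rw [← cdf_eq_real γ x, le_sub_iff_add_le]
  refine ge_of_tendsto hc ?_
  filter_upwards [self_mem_nhdsWithin] with y hy
  rw [cdf_eq_real]; exact key y hy

lemma le_of_lt_Q (h : DisjointPair η γ a b) (hPQ : AttainsSup η γ a b P Q)
    (hu : u ∈ Ioo (0 : ℝ) 1) (hx : b ≤ x) (hxQ : x < Q u) :
    γ.real (Iic x) - γ.real (Iic a) ≤ 1 - u - phiFn η γ a b u := by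
  obtain ⟨hP, hQ, -, -, -⟩ := hPQ u hu
  have h1 := h.Efun_sub_le_phiFn hu hP hx
  have h2 := attained hPQ hu
  have h3 := h.le_Dfun_sub_right hx hxQ.le
  rw [Efun_eq] at h1 h2
  refine le_of_mul_le_mul_right ?_ (sub_pos.2 hxQ)
  linarith

end DisjointPair

section UnitInterval

open Filter Topology

lemma integral_eq_sub_of_subgradient_s8 {φ m : ℝ → ℝ}
    (hsub : ∀ u ∈ Ioo (0 : ℝ) 1, ∀ v ∈ Ioo (0 : ℝ) 1, φ u - m u * (v - u) ≤ φ v)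
    (hm : AntitoneOn m (Ioo 0 1)) (hm01 : ∀ u ∈ Ioo (0 : ℝ) 1, m u ∈ Ioo (0 : ℝ) 1) {s t : ℝ}
    (hs : s ∈ Ioo (0 : ℝ) 1) (ht : t ∈ Ioo (0 : ℝ) 1) (hst : s ≤ t) :
    ∫ x in s..t, m x = φ s - φ t := by
  have hsubset : Icc s t ⊆ Ioo 0 1 := fun x hx => ⟨hs.1.trans_le hx.1, hx.2.trans_lt ht.2⟩
  have hlip : LipschitzOnWith 1 φ (Ioo 0 1) := LipschitzOnWith.of_le_add fun x hx y hy => by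
    have h1 := hsub x hx y hy
    have h2 := hm01 x hx
    rw [Real.dist_eq, abs_sub_comm]
    nlinarith [le_abs_self (y - x), abs_nonneg (y - x), h2.1, h2.2]
  have hderiv : ∀ x ∈ Ioo s t \ {x | x ∈ Ioo 0 1 ∧ ¬ContinuousWithinAt m (Ioo 0 1) x},
      HasDerivAt (fun x => -φ x) (m x) x := by
    rintro x ⟨hx, hxc⟩
    have hx01 := hsubset (Ioo_subset_Icc_self hx)
    have hnhds : Ioo (0 : ℝ) 1 ∈ 𝓝 x := Ioo_mem_nhds hx01.1 hx01.2
    have hc : ContinuousAt m x := by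
      by_contra hnc
      exact hxc ⟨hx01, fun h => hnc (h.continuousAt hnhds)⟩
    rw [hasDerivAt_iff_isLittleO, Asymptotics.isLittleO_iff]
    intro c hc0
    filter_upwards [hnhds, Metric.continuousAt_iff'.1 hc c hc0] with v hv hvc
    have h1 := hsub x hx01 v hv
    have h2 := hsub v hv x hx01
    rw [Real.dist_eq] at hvc
    have h3 : |(m v - m x) * (v - x)| ≤ c * |v - x| := by
      rw [abs_mul]; exact mul_le_mul_of_nonneg_right hvc.le (abs_nonneg _)
    have h4 := (abs_le.1 h3).1
    rw [Real.norm_eq_abs, Real.norm_eq_abs, smul_eq_mul, abs_le]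
    constructor
    · linarith
    · linarith [mul_nonneg hc0.le (abs_nonneg (v - x))]
  rw [integral_eq_of_hasDerivAt_off_countable_of_le (fun x => -φ x) m hst
    hm.countable_not_continuousWithinAt (hlip.continuousOn.neg.mono hsubset) hderiv
    (AntitoneOn.intervalIntegrable (hm.mono (by rwa [uIcc_of_le hst])))]
  ring

variable {w φ : ℝ → ℝ}

lemma intervalIntegral_tail_eq (hw : IntervalIntegrable w volume 0 1)
    (hFTC : ∀ s ∈ Ioo (0 : ℝ) 1, ∀ t ∈ Ioo (0 : ℝ) 1, s ≤ t → ∫ x in s..t, w x = φ s - φ t)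
    (h1 : Tendsto φ (𝓝[<] 1) (𝓝 0)) {u : ℝ} (hu : u ∈ Ioo (0 : ℝ) 1) :
    ∫ x in u..1, w x = φ u := by
  have hc := intervalIntegral.continuousOn_primitive_interval' hw
    (a := u) (by rw [uIcc_of_le zero_le_one]; exact Ioo_subset_Icc_self hu)
  rw [uIcc_of_le zero_le_one] at hc
  have hl : Tendsto (fun t => ∫ x in u..t, w x) (𝓝[<] 1) (𝓝 (∫ x in u..1, w x)) := by
    rw [← nhdsWithin_Ioo_eq_nhdsLT (zero_lt_one' ℝ)]
    exact (hc 1 ⟨zero_le_one, le_rfl⟩).mono_left (nhdsWithin_mono _ Ioo_subset_Icc_self)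
  have hr : Tendsto (fun t => ∫ x in u..t, w x) (𝓝[<] 1) (𝓝 (φ u - 0)) := by
    refine (tendsto_const_nhds.sub h1).congr' ?_
    filter_upwards [Ioo_mem_nhdsLT hu.2] with t ht
    exact (hFTC u hu t ⟨hu.1.trans ht.1, ht.2⟩ ht.1.le).symm
  rw [tendsto_nhds_unique hl hr, sub_zero]

lemma continuousOn_tail (hw : IntervalIntegrable w volume 0 1) :
    ContinuousOn (fun u => ∫ x in u..1, w x) (Icc 0 1) := by
  have hc := intervalIntegral.continuousOn_primitive_interval' hw
    (a := 1) (by rw [uIcc_of_le zero_le_one]; exact ⟨zero_le_one, le_rfl⟩)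
  rw [uIcc_of_le zero_le_one] at hc
  exact hc.neg.congr fun u _ => intervalIntegral.integral_symm _ _

lemma tendsto_tail_right (hw : IntervalIntegrable w volume 0 1) {u : ℝ} (hu : u ∈ Ico (0 : ℝ) 1) :
    Tendsto (fun u => ∫ x in u..1, w x) (𝓝[>] u) (𝓝 (∫ x in u..1, w x)) := by
  rw [← nhdsWithin_Ioo_eq_nhdsGT hu.2]
  exact (continuousOn_tail hw u ⟨hu.1, hu.2.le⟩).mono_left
    (nhdsWithin_mono _ fun v hv => ⟨hu.1.trans hv.1.le, hv.2.le⟩)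

lemma tendsto_tail_left (hw : IntervalIntegrable w volume 0 1) {u : ℝ} (hu : u ∈ Ioc (0 : ℝ) 1) :
    Tendsto (fun u => ∫ x in u..1, w x) (𝓝[<] u) (𝓝 (∫ x in u..1, w x)) := by
  rw [← nhdsWithin_Ioo_eq_nhdsLT hu.1]
  exact (continuousOn_tail hw u ⟨hu.1.le, hu.2⟩).mono_left
    (nhdsWithin_mono _ fun v hv => ⟨hv.1.le, hv.2.le.trans hu.2⟩)

/-- The integral over an upper subset of `(0, 1)` whose threshold is located by comparing the
tail integrals with `c` is `c`. -/
lemma setIntegral_upper_eq (hw : IntervalIntegrable w volume 0 1) {S : Set ℝ} {c : ℝ}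
    (hS01 : S ⊆ Ioo 0 1) (hS : ∀ u ∈ S, ∀ v ∈ Ioo (0 : ℝ) 1, u ≤ v → v ∈ S)
    (hc0 : 0 ≤ c) (hc1 : c ≤ ∫ x in (0 : ℝ)..1, w x) (h1 : ∀ u ∈ S, ∫ x in u..1, w x ≤ c)
    (h2 : ∀ u ∈ Ioo (0 : ℝ) 1, u ∉ S → c ≤ ∫ x in u..1, w x) :
    ∫ x in S, w x = c := by
  set s := sInf (insert 1 S)
  have hbdd : BddBelow (insert 1 S) := ⟨0, by
    rintro x (rfl | hx)
    · exact zero_le_one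
    · exact (hS01 hx).1.le⟩
  have hs1 : s ≤ 1 := csInf_le hbdd (mem_insert _ _)
  have hs0 : 0 ≤ s := le_csInf (insert_nonempty _ _) (by
    rintro x (rfl | hx)
    · exact zero_le_one
    · exact (hS01 hx).1.le)
  have hmem : ∀ u ∈ Ioo s 1, u ∈ S := fun u hu => by
    obtain ⟨v, hv, hvu⟩ := exists_lt_of_csInf_lt (insert_nonempty _ _) hu.1
    rcases hv with rfl | hv
    · exact absurd hu.2 (not_lt.2 hvu.le)
    · exact hS v hv u ⟨hs0.trans_lt hu.1, hu.2⟩ hvu.le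
  have hnot : ∀ u < s, u ∉ S := fun u hu huS =>
    absurd (csInf_le hbdd (mem_insert_of_mem _ huS)) (not_le.2 hu)
  have hae : S =ᵐ[volume] Ioc s 1 := by
    have hl : Ioo s 1 ⊆ S := hmem
    have hr : S ⊆ Icc s 1 := fun u hu => ⟨not_lt.1 fun h => hnot u h hu, (hS01 hu).2.le⟩
    exact (hr.eventuallyLE.trans Ioc_ae_eq_Icc.symm.le).antisymm
      (Ioo_ae_eq_Ioc.symm.le.trans hl.eventuallyLE)
  rw [setIntegral_congr_set hae, ← intervalIntegral.integral_of_le hs1]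
  refine le_antisymm ?_ ?_
  · rcases hs1.eq_or_lt with heq | hlt
    · rw [heq, intervalIntegral.integral_same]; exact hc0
    · refine le_of_tendsto (tendsto_tail_right hw ⟨hs0, hlt⟩) ?_
      filter_upwards [Ioo_mem_nhdsGT hlt] with u hu
      exact h1 u (hmem u hu)
  · rcases hs0.eq_or_lt with heq | hlt
    · rw [← heq]; exact hc1
    · refine ge_of_tendsto (tendsto_tail_left hw ⟨hlt, hs1⟩) ?_
      filter_upwards [Ioo_mem_nhdsLT hlt] with u hu
      exact h2 u ⟨hu.1, hu.2.trans_le hs1⟩ (hnot u hu.2)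

lemma volume_split_le {m p q x : ℝ} (hm : m ∈ Ioo (0 : ℝ) 1) :
    volume.restrict (Ioo (0 : ℝ) 1) {v | (if v ≤ m then p else q) ≤ x} =
      ENNReal.ofReal ((if p ≤ x then m else 0) + (if q ≤ x then 1 - m else 0)) := by
  rw [Measure.restrict_apply' measurableSet_Ioo]
  by_cases hp : p ≤ x <;> by_cases hq : q ≤ x
  · have : {v | (if v ≤ m then p else q) ≤ x} ∩ Ioo 0 1 = Ioo (0 : ℝ) 1 := by
      refine inter_eq_right.2 fun v _ => ?_
      change (if v ≤ m then p else q) ≤ x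
      split_ifs <;> assumption
    rw [this, Real.volume_Ioo]; simp [hp, hq]
  · have : {v | (if v ≤ m then p else q) ≤ x} ∩ Ioo 0 1 = Ioc (0 : ℝ) m := by
      ext v
      change (if v ≤ m then p else q) ≤ x ∧ v ∈ Ioo (0 : ℝ) 1 ↔ v ∈ Ioc 0 m
      constructor
      · rintro ⟨h, hv⟩
        split_ifs at h with hvm
        · exact ⟨hv.1, hvm⟩
        · exact absurd h hq
      · exact fun hv => ⟨by rwa [if_pos hv.2], hv.1, hv.2.trans_lt hm.2⟩
    rw [this, Real.volume_Ioc]; simp [hp, hq]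
  · have : {v | (if v ≤ m then p else q) ≤ x} ∩ Ioo 0 1 = Ioo (m : ℝ) 1 := by
      ext v
      change (if v ≤ m then p else q) ≤ x ∧ v ∈ Ioo (0 : ℝ) 1 ↔ v ∈ Ioo m 1
      constructor
      · rintro ⟨h, hv⟩
        split_ifs at h with hvm
        · exact absurd h hp
        · exact ⟨not_le.1 hvm, hv.2⟩
      · exact fun hv => ⟨by rwa [if_neg (not_le.2 hv.1)], hm.1.trans hv.1, hv.2⟩
    rw [this, Real.volume_Ioo]; simp [hp, hq]
  · have : {v | (if v ≤ m then p else q) ≤ x} ∩ Ioo 0 1 = (∅ : Set ℝ) := by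
      refine eq_empty_of_forall_notMem fun v hv => ?_
      have h : (if v ≤ m then p else q) ≤ x := hv.1
      split_ifs at h
      exacts [hp h, hq h]
    rw [this]; simp [hp, hq]

end UnitInterval

namespace DisjointPair

open Filter Topology

variable {η γ : Measure ℝ} [IsProbabilityMeasure η] [IsProbabilityMeasure γ] {a b u x : ℝ}
  {P Q : ℝ → ℝ}

lemma integrableOn_weight (h : DisjointPair η γ a b) (hPQ : AttainsSup η γ a b P Q) :
    IntegrableOn (weight η P Q) (Ioo 0 1) := by
  refine Integrable.of_bound (aemeasurable_restrict_of_antitoneOn measurableSet_Ioo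
    (h.antitoneOn_weight hPQ)).aestronglyMeasurable 1 ?_
  filter_upwards [ae_restrict_mem measurableSet_Ioo] with u hu
  have := weight_mem hPQ hu
  rw [Real.norm_eq_abs, abs_of_pos this.1]
  exact this.2.le

lemma intervalIntegrable_weight (h : DisjointPair η γ a b) (hPQ : AttainsSup η γ a b P Q) :
    IntervalIntegrable (weight η P Q) volume 0 1 := by
  rw [intervalIntegrable_iff_integrableOn_Ioo_of_le zero_le_one]
  exact h.integrableOn_weight hPQ

lemma tail_weight (h : DisjointPair η γ a b) (hPQ : AttainsSup η γ a b P Q)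
    (hu : u ∈ Ioo (0 : ℝ) 1) : ∫ x in u..1, weight η P Q x = phiFn η γ a b u := by
  refine intervalIntegral_tail_eq (h.intervalIntegrable_weight hPQ)
    (fun s hs t ht hst => integral_eq_sub_of_subgradient_s8
      (fun u hu v hv => h.subgradient hPQ hu hv) (h.antitoneOn_weight hPQ)
      (fun u hu => weight_mem hPQ hu) hs ht hst) ?_ hu
  have hlim : Tendsto (fun u : ℝ => 1 - u) (𝓝[<] 1) (𝓝 0) := by
    have : Tendsto (fun u : ℝ => 1 - u) (𝓝 1) (𝓝 (1 - 1)) := by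
      exact (continuous_const.sub continuous_id).tendsto 1
    rw [sub_self] at this
    exact this.mono_left nhdsWithin_le_nhds
  refine tendsto_of_tendsto_of_tendsto_of_le_of_le' tendsto_const_nhds hlim ?_ ?_
  · filter_upwards [Ioo_mem_nhdsLT (zero_lt_one' ℝ)] with u hu using h.phiFn_nonneg hu
  · filter_upwards [Ioo_mem_nhdsLT (zero_lt_one' ℝ)] with u hu using (h.phiFn_le hu hPQ).2

lemma integral_weight (h : DisjointPair η γ a b) (hPQ : AttainsSup η γ a b P Q) :
    ∫ x in (0 : ℝ)..1, weight η P Q x = γ.real (Iic a) := by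
  have h1 := tendsto_tail_right (h.intervalIntegrable_weight hPQ) (u := 0) ⟨le_rfl, one_pos⟩
  refine tendsto_nhds_unique h1 ?_
  have hlim : Tendsto (fun u : ℝ => γ.real (Iic a) - u) (𝓝[>] 0) (𝓝 (γ.real (Iic a))) := by
    have : Tendsto (fun u : ℝ => γ.real (Iic a) - u) (𝓝 0) (𝓝 (γ.real (Iic a) - 0)) := by
      exact (continuous_const.sub continuous_id).tendsto 0
    rw [sub_zero] at this
    exact this.mono_left nhdsWithin_le_nhds
  refine tendsto_of_tendsto_of_tendsto_of_le_of_le' hlim tendsto_const_nhds ?_ ?_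
  · filter_upwards [Ioo_mem_nhdsGT (zero_lt_one' ℝ)] with u hu
    rw [h.tail_weight hPQ hu]; exact h.sub_le_phiFn hu
  · filter_upwards [Ioo_mem_nhdsGT (zero_lt_one' ℝ)] with u hu
    rw [h.tail_weight hPQ hu]; exact (h.phiFn_le hu hPQ).1

lemma intervalIntegral_one_sub_weight (h : DisjointPair η γ a b) (hPQ : AttainsSup η γ a b P Q)
    (hu : u ∈ Icc (0 : ℝ) 1) :
    ∫ x in u..1, (1 - weight η P Q x) = 1 - u - ∫ x in u..1, weight η P Q x := by
  rw [intervalIntegral.integral_sub intervalIntegrable_const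
    ((h.intervalIntegrable_weight hPQ).mono_set ?_)]
  · simp
  · rw [uIcc_of_le hu.2, uIcc_of_le zero_le_one]
    exact Icc_subset_Icc_left hu.1

lemma setIntegral_weight_P (h : DisjointPair η γ a b) (hPQ : AttainsSup η γ a b P Q)
    (hP : AntitoneOn P (Ioo 0 1)) (x : ℝ) :
    ∫ u in Ioo 0 1 ∩ {u | P u ≤ x}, weight η P Q u = γ.real (Iic (min x a)) := by
  rcases lt_or_ge x a with hx | hx
  · rw [min_eq_left hx.le]
    refine setIntegral_upper_eq (h.intervalIntegrable_weight hPQ) inter_subset_left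
      (fun u hu v hv huv => ⟨hv, (hP hu.1 hv huv).trans hu.2⟩) measureReal_nonneg ?_ ?_ ?_
    · rw [h.integral_weight hPQ]
      exact measureReal_mono (Iic_subset_Iic.2 hx.le)
    · intro u hu
      rw [h.tail_weight hPQ hu.1]
      exact h.phiFn_le_of_P_le hPQ hu.1 hx hu.2
    · intro u hu huS
      rw [h.tail_weight hPQ hu]
      exact h.le_phiFn_of_lt_P hPQ hu (not_le.1 fun hle => huS ⟨hu, hle⟩)
  · have hset : Ioo 0 1 ∩ {u | P u ≤ x} = Ioo (0 : ℝ) 1 :=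
      inter_eq_left.2 fun u hu => (hPQ u hu).1.trans hx
    rw [min_eq_right hx, hset, ← integral_Ioc_eq_integral_Ioo,
      ← intervalIntegral.integral_of_le zero_le_one, h.integral_weight hPQ]

lemma setIntegral_one_sub_weight_Q (h : DisjointPair η γ a b) (hPQ : AttainsSup η γ a b P Q)
    (hQ : AntitoneOn Q (Ioo 0 1)) (x : ℝ) :
    ∫ u in Ioo 0 1 ∩ {u | Q u ≤ x}, (1 - weight η P Q u) =
      γ.real (Iic x) - γ.real (Iic (min x a)) := by
  rcases lt_or_ge x b with hx | hx
  · have hset : Ioo 0 1 ∩ {u | Q u ≤ x} = ∅ :=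
      eq_empty_of_forall_notMem fun u hu =>
        absurd ((hPQ u hu.1).2.1.trans hu.2) (not_le.2 hx)
    rw [hset, setIntegral_empty]
    rcases le_total x a with hxa | hxa
    · rw [min_eq_left hxa, sub_self]
    · rw [min_eq_right hxa, h.right_Iic hxa hx, sub_self]
  · rw [min_eq_right (h.lt.le.trans hx)]
    refine setIntegral_upper_eq
      (intervalIntegrable_const.sub (h.intervalIntegrable_weight hPQ)) inter_subset_left
      (fun u hu v hv huv => ⟨hv, (hQ hu.1 hv huv).trans hu.2⟩)
      (sub_nonneg.2 (measureReal_mono (Iic_subset_Iic.2 (h.lt.le.trans hx)))) ?_ ?_ ?_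
    · rw [h.intervalIntegral_one_sub_weight hPQ ⟨le_rfl, zero_le_one⟩, h.integral_weight hPQ,
        sub_zero]
      exact sub_le_sub_right measureReal_le_one _
    · intro u hu
      rw [h.intervalIntegral_one_sub_weight hPQ (Ioo_subset_Icc_self hu.1),
        h.tail_weight hPQ hu.1]
      exact h.le_of_Q_le hPQ hu.1 hu.2
    · intro u hu huS
      rw [h.intervalIntegral_one_sub_weight hPQ (Ioo_subset_Icc_self hu), h.tail_weight hPQ hu]
      exact h.le_of_lt_Q hPQ hu hx (not_le.1 fun hle => huS ⟨hu, hle⟩)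

/-- The second marginal of the two-point splitting of the quantile coupling is `γ`. -/
lemma map_split (h : DisjointPair η γ a b) (hPQ : AttainsSup η γ a b P Q)
    (hPm : Measurable P) (hQm : Measurable Q)
    (hP : AntitoneOn P (Ioo 0 1)) (hQ : AntitoneOn Q (Ioo 0 1)) {w : ℝ → ℝ} (hwm : Measurable w)
    (hw : weight η P Q =ᵐ[volume.restrict (Ioo 0 1)] w) :
    ((volume.restrict (Ioo (0 : ℝ) 1)).prod (volume.restrict (Ioo (0 : ℝ) 1))).map
      (fun p => if p.2 ≤ w p.1 then P p.1 else Q p.1) = γ := by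
  refine (Measure.ext_of_Iic _ _ fun x => ?_).symm
  have hmeas : Measurable (fun p : ℝ × ℝ => if p.2 ≤ w p.1 then P p.1 else Q p.1) :=
    Measurable.ite (measurableSet_le measurable_snd (hwm.comp measurable_fst))
      (hPm.comp measurable_fst) (hQm.comp measurable_fst)
  have hPs : MeasurableSet {u | P u ≤ x} := hPm measurableSet_Iic
  have hQs : MeasurableSet {u | Q u ≤ x} := hQm measurableSet_Iic
  have hI := h.integrableOn_weight hPQ
  have hI' : IntegrableOn (fun u => 1 - weight η P Q u) (Ioo 0 1) :=
    (integrable_const (1 : ℝ)).sub hI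
  set f : ℝ → ℝ := fun u => {u | P u ≤ x}.indicator (weight η P Q) u +
    {u | Q u ≤ x}.indicator (fun u => 1 - weight η P Q u) u with hf
  rw [Measure.map_apply hmeas measurableSet_Iic, Measure.prod_apply (hmeas measurableSet_Iic)]
  have hcongr : (fun u => volume.restrict (Ioo (0 : ℝ) 1) (Prod.mk u ⁻¹'
      ((fun p : ℝ × ℝ => if p.2 ≤ w p.1 then P p.1 else Q p.1) ⁻¹' Iic x)))
      =ᵐ[volume.restrict (Ioo 0 1)] fun u => ENNReal.ofReal (f u) := by
    filter_upwards [ae_restrict_mem measurableSet_Ioo, hw] with u hu hwu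
    refine (volume_split_le (p := P u) (q := Q u) (x := x) (hwu ▸ weight_mem hPQ hu)).trans ?_
    simp only [hf, indicator_apply, mem_ofPred_eq, hwu]
  have hf0 : 0 ≤ᵐ[volume.restrict (Ioo (0 : ℝ) 1)] f := by
    filter_upwards [ae_restrict_mem measurableSet_Ioo] with u hu
    have := weight_mem hPQ hu
    refine add_nonneg (indicator_apply_nonneg fun _ => this.1.le)
      (indicator_apply_nonneg fun _ => by linarith [this.2])
  have hfint : IntegrableOn f (Ioo 0 1) := (hI.indicator hPs).add (hI'.indicator hQs)
  have hfi : ∫ u in Ioo 0 1, f u = γ.real (Iic x) := by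
    rw [hf, integral_add (hI.indicator hPs) (hI'.indicator hQs), setIntegral_indicator hPs,
      setIntegral_indicator hQs, h.setIntegral_weight_P hPQ hP,
      h.setIntegral_one_sub_weight_Q hPQ hQ]
    ring
  rw [lintegral_congr_ae hcongr, ← ofReal_integral_eq_lintegral_ofReal hfint hf0, hfi]
  exact (ENNReal.ofReal_toReal (measure_ne_top _ _)).symm

end DisjointPair

lemma map_ite_mixture {Ω : Type*} [MeasurableSpace Ω] {Pr : Measure Ω} {Z W T : Ω → ℝ} {κ : ℝ}
    (hZ : Measurable Z) (hW : Measurable W) (hT : Measurable T)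
    (hZlaw : Pr.map Z = ENNReal.ofReal κ • Measure.dirac (1 : ℝ)
      + ENNReal.ofReal (1 - κ) • Measure.dirac (0 : ℝ))
    (hZW : IndepFun Z W Pr) (hZT : IndepFun Z T Pr) :
    Pr.map (fun ω => if Z ω = 1 then W ω else T ω) =
      ENNReal.ofReal κ • Pr.map W + ENNReal.ofReal (1 - κ) • Pr.map T := by
  have hone : MeasurableSet ({1} : Set ℝ) := measurableSet_singleton 1
  have hmeas : Measurable (fun ω => if Z ω = 1 then W ω else T ω) :=
    Measurable.ite (hZ hone) hW hT
  have h1 : Pr (Z ⁻¹' {1}) = ENNReal.ofReal κ := by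
    rw [← Measure.map_apply hZ hone, hZlaw]; simp
  have h0 : Pr (Z ⁻¹' {1}ᶜ) = ENNReal.ofReal (1 - κ) := by
    rw [← Measure.map_apply hZ hone.compl, hZlaw]; simp
  ext A hA
  have hset : (fun ω => if Z ω = 1 then W ω else T ω) ⁻¹' A =
      (Z ⁻¹' {1} ∩ W ⁻¹' A) ∪ (Z ⁻¹' {1}ᶜ ∩ T ⁻¹' A) := by
    ext ω
    by_cases hω : Z ω = 1 <;> simp [hω]
  rw [Measure.map_apply hmeas hA, hset, measure_union _ ((hZ hone.compl).inter (hT hA)),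
    hZW.measure_inter_preimage_eq_mul _ _ hone hA,
    hZT.measure_inter_preimage_eq_mul _ _ hone.compl hA, h1, h0, Measure.add_apply,
    Measure.smul_apply, Measure.smul_apply, Measure.map_apply hW hA, Measure.map_apply hT hA,
    smul_eq_mul, smul_eq_mul]
  exact disjoint_left.2 fun ω hω hω' => hω'.1 hω.1

section PosPart

variable {μ ν : Measure ℝ}

lemma posPartMeasure_le [IsFiniteMeasure μ] [IsFiniteMeasure ν] : posPartMeasure μ ν ≤ μ :=
  (Measure.le_add_left le_rfl).trans (inf_add_posPartMeasure μ ν).le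

lemma integral_posPartMeasure [IsFiniteMeasure μ] [IsFiniteMeasure ν] {f : ℝ → ℝ}
    (hf : Integrable f μ) :
    ∫ y, f y ∂posPartMeasure μ ν = ∫ y, f y ∂μ - ∫ y, f y ∂(μ ⊓ ν) := by
  have h := integral_add_measure (hf.mono_measure (inf_le_left : μ ⊓ ν ≤ μ))
    (hf.mono_measure (posPartMeasure_le (ν := ν)))
  rw [inf_add_posPartMeasure] at h
  rw [h]; ring

lemma posPartMeasure_univ [IsProbabilityMeasure μ] [IsFiniteMeasure ν] :
    posPartMeasure μ ν univ = ENNReal.ofReal (1 - ((μ ⊓ ν) univ).toReal) := by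
  have hfin : (μ ⊓ ν) univ ≠ ∞ := ne_top_of_le_ne_top (measure_ne_top μ univ)
    (Measure.le_iff'.1 inf_le_left _)
  have h : (μ ⊓ ν) univ + posPartMeasure μ ν univ = 1 := by
    rw [← Measure.add_apply, inf_add_posPartMeasure, measure_univ]
  rw [ENNReal.ofReal_sub _ ENNReal.toReal_nonneg, ENNReal.ofReal_one, ENNReal.ofReal_toReal hfin,
    ← h, ENNReal.add_sub_cancel_left hfin]

lemma smul_inf_add_smul_posPart [IsProbabilityMeasure μ] [IsFiniteMeasure ν]
    (hκ0 : 0 < ((μ ⊓ ν) univ).toReal) (hκ1 : ((μ ⊓ ν) univ).toReal < 1) :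
    ENNReal.ofReal ((μ ⊓ ν) univ).toReal • ((μ ⊓ ν) univ)⁻¹ • (μ ⊓ ν) +
      ENNReal.ofReal (1 - ((μ ⊓ ν) univ).toReal) •
        (posPartMeasure μ ν univ)⁻¹ • posPartMeasure μ ν = μ := by
  obtain ⟨h0, hfin⟩ := ENNReal.toReal_pos_iff.1 hκ0
  rw [← posPartMeasure_univ, ENNReal.ofReal_toReal hfin.ne, smul_smul, smul_smul,
    ENNReal.mul_inv_cancel h0.ne' hfin.ne, ENNReal.mul_inv_cancel, one_smul, one_smul,
    inf_add_posPartMeasure]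
  · rw [posPartMeasure_univ]
    exact (ENNReal.ofReal_pos.2 (sub_pos.2 hκ1)).ne'
  · rw [posPartMeasure_univ]; exact ENNReal.ofReal_ne_top

lemma isProbabilityMeasure_normalized [IsProbabilityMeasure μ] [IsFiniteMeasure ν]
    (hκ1 : ((μ ⊓ ν) univ).toReal < 1) :
    IsProbabilityMeasure ((posPartMeasure μ ν univ)⁻¹ • posPartMeasure μ ν) := by
  constructor
  rw [Measure.smul_apply, smul_eq_mul, ENNReal.inv_mul_cancel]
  · rw [posPartMeasure_univ]
    exact (ENNReal.ofReal_pos.2 (sub_pos.2 hκ1)).ne'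
  · rw [posPartMeasure_univ]; exact ENNReal.ofReal_ne_top

lemma integrable_normalized [IsProbabilityMeasure μ] [IsFiniteMeasure ν]
    (hκ1 : ((μ ⊓ ν) univ).toReal < 1) {f : ℝ → ℝ} (hf : Integrable f μ) :
    Integrable f ((posPartMeasure μ ν univ)⁻¹ • posPartMeasure μ ν) := by
  refine (hf.mono_measure posPartMeasure_le).smul_measure (ENNReal.inv_ne_top.2 ?_)
  rw [posPartMeasure_univ]
  exact (ENNReal.ofReal_pos.2 (sub_pos.2 hκ1)).ne'

lemma integral_normalized [IsProbabilityMeasure μ] [IsFiniteMeasure ν] {f : ℝ → ℝ}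
    (hf : Integrable f μ) :
    ∫ y, f y ∂((posPartMeasure μ ν univ)⁻¹ • posPartMeasure μ ν) =
      (ENNReal.ofReal (1 - ((μ ⊓ ν) univ).toReal))⁻¹.toReal *
        (∫ y, f y ∂μ - ∫ y, f y ∂(μ ⊓ ν)) := by
  rw [integral_smul_measure, integral_posPartMeasure hf, posPartMeasure_univ, smul_eq_mul]

lemma disjointPair_normalized [IsProbabilityMeasure μ] [IsProbabilityMeasure ν] {a b : ℝ}
    (hab : a < b) (hμ : Integrable id μ) (hν : Integrable id ν)
    (hmean : ∫ x, x ∂μ = ∫ x, x ∂ν) (hC : ∀ x, Cfun μ x ≤ Cfun ν x)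
    (hκ1 : ((μ ⊓ ν) univ).toReal < 1)
    (hη : posPartMeasure μ ν (Icc a b)ᶜ = 0) (hγ : posPartMeasure ν μ (Ioo a b) = 0) :
    DisjointPair ((posPartMeasure μ ν univ)⁻¹ • posPartMeasure μ ν)
      ((posPartMeasure ν μ univ)⁻¹ • posPartMeasure ν μ) a b where
  lt := hab
  integrable_left := integrable_normalized hκ1 hμ
  integrable_right := integrable_normalized (inf_comm μ ν ▸ hκ1) hν
  mean_eq := by
    rw [integral_normalized (f := fun y => y) hμ, integral_normalized (f := fun y => y) hν,
      inf_comm ν μ, hmean]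
  Cfun_le x := by
    unfold Cfun
    rw [integral_normalized (integrable_call hμ x), integral_normalized (integrable_call hν x),
      inf_comm ν μ]
    exact mul_le_mul_of_nonneg_left (sub_le_sub_right (hC x) _) ENNReal.toReal_nonneg
  left_compl := by rw [Measure.smul_apply, hη, smul_zero]
  right_Ioo := by rw [Measure.smul_apply, hγ, smul_zero]

end PosPart

theorem stmt8 (a b : ℝ) (hab : a < b) (μ ν : Measure ℝ)
    [IsProbabilityMeasure μ] [IsProbabilityMeasure ν]
    (hμ1 : Integrable id μ) (hν1 : Integrable id ν)
    (hmean : ∫ x, x ∂μ = ∫ x, x ∂ν)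
    (hC : ∀ x : ℝ, Cfun μ x ≤ Cfun ν x)
    (hκ0 : 0 < ((μ ⊓ ν) univ).toReal) (hκ1 : ((μ ⊓ ν) univ).toReal < 1)
    (hsupη : posPartMeasure μ ν (Icc a b)ᶜ = 0)
    (hsupγ : posPartMeasure ν μ (Ioo a b) = 0)
    -- normalised measures η̄, γ̄
    (ηbar γbar : Measure ℝ)
    (hηbar : ηbar = (posPartMeasure μ ν univ)⁻¹ • posPartMeasure μ ν)
    (hγbar : γbar = (posPartMeasure ν μ univ)⁻¹ • posPartMeasure ν μ)
    (P Q : ℝ → ℝ) (hPQ : AttainsSup ηbar γbar a b P Q)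
    (hPmeas : Measurable P) (hQmeas : Measurable Q)
    (hPmono : AntitoneOn P (Ioo 0 1)) (hQmono : AntitoneOn Q (Ioo 0 1))
    {Ω : Type*} [MeasurableSpace Ω] (Pr : Measure Ω) [IsProbabilityMeasure Pr]
    (U V Z W : Ω → ℝ)
    (hU : Measurable U) (hV : Measurable V) (hZ : Measurable Z) (hW : Measurable W)
    (hUlaw : Pr.map U = volume.restrict (Ioo (0 : ℝ) 1))
    (hVlaw : Pr.map V = volume.restrict (Ioo (0 : ℝ) 1))
    (hZlaw : Pr.map Z = ENNReal.ofReal (((μ ⊓ ν) univ).toReal) • Measure.dirac (1 : ℝ)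
        + ENNReal.ofReal (1 - ((μ ⊓ ν) univ).toReal) • Measure.dirac (0 : ℝ))
    (hWlaw : Pr.map W = ((μ ⊓ ν) univ)⁻¹ • (μ ⊓ ν))
    (hUV : IndepFun U V Pr)
    (hWUV : IndepFun W (fun ω => (U ω, V ω)) Pr)
    (hZrest : IndepFun Z (fun ω => (U ω, V ω, W ω)) Pr) :
    Pr.map (fun ω => if Z ω = 1 then W ω else Finv ηbar (U ω)) = μ ∧
    Pr.map (fun ω => if Z ω = 1 then W ω else
      (if V ω ≤ (Q (U ω) - Finv ηbar (U ω)) / (Q (U ω) - P (U ω))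
       then P (U ω) else Q (U ω))) = ν := by
  have hκ1' : ((ν ⊓ μ) univ).toReal < 1 := by rwa [inf_comm]
  have hpair : DisjointPair ηbar γbar a b := by
    rw [hηbar, hγbar]
    exact disjointPair_normalized hab hμ1 hν1 hmean hC hκ1 hsupη hsupγ
  have hη : IsProbabilityMeasure ηbar := hηbar ▸ isProbabilityMeasure_normalized hκ1
  have hγ : IsProbabilityMeasure γbar := hγbar ▸ isProbabilityMeasure_normalized hκ1'
  have hG : AEMeasurable (Finv ηbar) (volume.restrict (Ioo (0 : ℝ) 1)) := aemeasurable_Finv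
  set G := hG.mk (Finv ηbar)
  have hGm : Measurable G := hG.measurable_mk
  have hGae : Finv ηbar =ᵐ[volume.restrict (Ioo (0 : ℝ) 1)] G := hG.ae_eq_mk
  have hGU : ∀ᵐ ω ∂Pr, Finv ηbar (U ω) = G (U ω) :=
    ae_of_ae_map hU.aemeasurable (hUlaw ▸ hGae)
  have hZW : IndepFun Z W Pr := hZrest.comp measurable_id (measurable_snd.comp measurable_snd)
  set w : ℝ → ℝ := fun u => (Q u - G u) / (Q u - P u)
  have hwm : Measurable w := (hQmeas.sub hGm).div (hQmeas.sub hPmeas)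
  have hw : DisjointPair.weight ηbar P Q =ᵐ[volume.restrict (Ioo 0 1)] w := by
    filter_upwards [hGae] with u hu
    simp only [DisjointPair.weight, w, hu]
  have hsplit : Measurable (fun p : ℝ × ℝ => if p.2 ≤ w p.1 then P p.1 else Q p.1) :=
    Measurable.ite (measurableSet_le measurable_snd (hwm.comp measurable_fst))
      (hPmeas.comp measurable_fst) (hQmeas.comp measurable_fst)
  constructor
  · have hcongr : (fun ω => if Z ω = 1 then W ω else Finv ηbar (U ω)) =ᵐ[Pr]
        fun ω => if Z ω = 1 then W ω else G (U ω) := by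
      filter_upwards [hGU] with ω hω
      rw [hω]
    have hZT : IndepFun Z (fun ω => G (U ω)) Pr :=
      hZrest.comp measurable_id (hGm.comp measurable_fst)
    have hTm : Measurable (fun ω => G (U ω)) := hGm.comp hU
    have hT : Pr.map (fun ω => G (U ω)) = ηbar := by
      change Pr.map (G ∘ U) = ηbar
      rw [← Measure.map_map hGm hU, hUlaw, ← Measure.map_congr hGae, map_Finv]
    rw [Measure.map_congr hcongr, map_ite_mixture hZ hW hTm hZlaw hZW hZT, hT, hWlaw,
      hηbar, smul_inf_add_smul_posPart hκ0 hκ1]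
  · have hcongr : (fun ω => if Z ω = 1 then W ω else
        (if V ω ≤ (Q (U ω) - Finv ηbar (U ω)) / (Q (U ω) - P (U ω))
          then P (U ω) else Q (U ω))) =ᵐ[Pr]
        fun ω => if Z ω = 1 then W ω else
          (if V ω ≤ w (U ω) then P (U ω) else Q (U ω)) := by
      filter_upwards [hGU] with ω hω
      simp only [hω, w]
    have hZT : IndepFun Z (fun ω => if V ω ≤ w (U ω) then P (U ω) else Q (U ω)) Pr :=
      hZrest.comp measurable_id
        (hsplit.comp (measurable_fst.prodMk (measurable_fst.comp measurable_snd)))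
    have hTm : Measurable (fun ω => if V ω ≤ w (U ω) then P (U ω) else Q (U ω)) :=
      hsplit.comp (hU.prodMk hV)
    have hT : Pr.map (fun ω => if V ω ≤ w (U ω) then P (U ω) else Q (U ω)) = γbar := by
      have hcomp : (fun ω => if V ω ≤ w (U ω) then P (U ω) else Q (U ω)) =
          (fun p : ℝ × ℝ => if p.2 ≤ w p.1 then P p.1 else Q p.1) ∘
            (fun ω => (U ω, V ω)) := rfl
      rw [hcomp, ← Measure.map_map hsplit (hU.prodMk hV),
        (indepFun_iff_map_prod_eq_prod_map_map hU.aemeasurable hV.aemeasurable).1 hUV,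
        hUlaw, hVlaw, hpair.map_split hPQ hPmeas hQmeas hPmono hQmono hwm hw]
    rw [Measure.map_congr hcongr, map_ite_mixture hZ hW hTm hZlaw hZW hZT, hT, hWlaw, hγbar,
      inf_comm μ ν]
    exact smul_inf_add_smul_posPart (inf_comm μ ν ▸ hκ0) hκ1'
end
end
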